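/- The ideal class group Cl₂₉ of the 29th cyclotomic field ℚ(ζ₂₉) is isomorphic to (ℤ/2ℤ)³, and complex conjugation induces the identity automorphism on Cl₂₉. Consequently the subgroup {x · x̄⁻¹ : x ∈ Cl₂₉} is trivial, while {x ∈ Cl₂₉ : x̄ = x⁻¹} is the whole class group, of order 8. -/

import Mathlib

open NumberField
open scoped nonZeroDivisors

section P1
set_option linter.unusedSectionVars false
set_option linter.style.haveILetI false
variable {K : Type} [Field K] [NumberField K] [IsCyclotomicExtension {(29 : ℕ)} ℚ K]
  {ζ : 𝓞 K}

theorem prK (hζ : IsPrimitiveRoot ζ 29) : IsPrimitiveRoot (ζ : K) 29 :=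
  hζ.map_of_injective (f := algebraMap (𝓞 K) K) (FaithfulSMul.algebraMap_injective (𝓞 K) K)

theorem toInt_eq (hζ : IsPrimitiveRoot ζ 29) : (prK hζ).toInteger = ζ := by
  ext; rfl

theorem hom_ext29 (hζ : IsPrimitiveRoot ζ 29) {R : Type*} [Ring R] {f g : 𝓞 K →+* R}
    (h : f ζ = g ζ) : f = g := by
  have h1 := IsCyclotomicExtension.Rat.adjoin_singleton_eq_top (prK hζ)
  rw [toInt_eq hζ] at h1
  have h2 : f.toIntAlgHom = g.toIntAlgHom := by
    apply AlgHom.ext_of_adjoin_eq_top h1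
    intro x hx
    rw [Set.mem_singleton_iff] at hx
    rw [hx]; exact h
  ext x
  exact DFunLike.congr_fun h2 x

theorem exists_hom (hζ : IsPrimitiveRoot ζ 29) {R : Type*} [CommRing R] (r : R)
    (hr : ∑ i ∈ Finset.range 29, r ^ i = 0) : ∃ f : 𝓞 K →+* R, f ζ = r := by
  let pb := (prK hζ).integralPowerBasis
  have hg : pb.gen = ζ := by
    rw [← toInt_eq hζ]; exact (prK hζ).integralPowerBasis_gen
  haveI : Fact (Nat.Prime 29) := ⟨by norm_num⟩
  have hm : minpoly ℤ pb.gen = Polynomial.cyclotomic 29 ℤ := by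
    rw [hg, Polynomial.cyclotomic_eq_minpoly (prK hζ) (by norm_num)]
    exact (minpoly.algebraMap_eq (FaithfulSMul.algebraMap_injective (𝓞 K) K) ζ).symm
  have h0 : Polynomial.aeval r (minpoly ℤ pb.gen) = 0 := by
    rw [hm, Polynomial.cyclotomic_prime]
    simpa using hr
  refine ⟨(pb.lift r h0).toRingHom, ?_⟩
  have := pb.lift_gen r h0
  rw [hg] at this
  exact this

theorem geom29 {R : Type*} [CommRing R] [IsDomain R] {r : R} (h : r ^ 29 = 1) (h1 : r ≠ 1) :
    ∑ i ∈ Finset.range 29, r ^ i = 0 := by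
  have := mul_geom_sum r 29
  rw [h, sub_self] at this
  exact (mul_eq_zero.mp this).resolve_left (sub_ne_zero.mpr h1)

theorem geomz (hζ : IsPrimitiveRoot ζ 29) : ∑ i ∈ Finset.range 29, ζ ^ i = 0 :=
  geom29 hζ.pow_eq_one (hζ.ne_one (by norm_num))

theorem pow_mod29 {R : Type*} [Monoid R] {r : R} (h : r ^ 29 = 1) (k : ℕ) : r ^ (k % 29) = r ^ k := by
  conv_rhs => rw [← Nat.div_add_mod k 29, pow_add, pow_mul, h, one_pow, one_mul]

theorem exists_sgh (hζ : IsPrimitiveRoot ζ 29) (c : ℕ) :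
    ∃ f : 𝓞 K →+* 𝓞 K, f ζ = if 29 ∣ c then ζ else ζ ^ c := by
  apply exists_hom hζ
  split_ifs with h
  · exact geomz hζ
  · apply geom29
    · rw [← pow_mul, mul_comm, pow_mul, hζ.pow_eq_one, one_pow]
    · intro h1; exact h (hζ.dvd_of_pow_eq_one c h1)

noncomputable def sgh (hζ : IsPrimitiveRoot ζ 29) (c : ℕ) : 𝓞 K →+* 𝓞 K := (exists_sgh hζ c).choose

theorem sgh_zeta (hζ : IsPrimitiveRoot ζ 29) {c : ℕ} (hc : ¬ 29 ∣ c) : sgh hζ c ζ = ζ ^ c := by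
  exact (exists_sgh hζ c).choose_spec.trans (if_neg hc)

theorem sgh_zeta' (hζ : IsPrimitiveRoot ζ 29) {c : ℕ} (hc : 29 ∣ c) : sgh hζ c ζ = ζ := by
  exact (exists_sgh hζ c).choose_spec.trans (if_pos hc)

theorem fermat29 {c : ℕ} (hc : ¬ 29 ∣ c) : c ^ 28 % 29 = 1 := by
  have h : Nat.Coprime c 29 := ((Nat.Prime.coprime_iff_not_dvd (by norm_num)).mpr hc).symm
  exact Nat.ModEq.pow_totient h

theorem sgh_inv (hζ : IsPrimitiveRoot ζ 29) (c : ℕ) :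
    (sgh hζ (c ^ 27)).comp (sgh hζ c) = RingHom.id _ := by
  apply hom_ext29 hζ
  have hp : Nat.Prime 29 := by norm_num
  by_cases hc : 29 ∣ c
  · simp [sgh_zeta' hζ hc, sgh_zeta' hζ (dvd_pow hc (by norm_num : 27 ≠ 0))]
  · have hc' : ¬ 29 ∣ c ^ 27 := fun h => hc (hp.dvd_of_dvd_pow h)
    simp only [RingHom.comp_apply, sgh_zeta hζ hc, map_pow, sgh_zeta hζ hc', RingHom.id_apply]
    rw [← pow_mul, ← pow_succ, ← pow_mod29 hζ.pow_eq_one, fermat29 hc, pow_one]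

theorem sgh_inv' (hζ : IsPrimitiveRoot ζ 29) (c : ℕ) :
    (sgh hζ c).comp (sgh hζ (c ^ 27)) = RingHom.id _ := by
  apply hom_ext29 hζ
  have hp : Nat.Prime 29 := by norm_num
  by_cases hc : 29 ∣ c
  · simp [sgh_zeta' hζ hc, sgh_zeta' hζ (dvd_pow hc (by norm_num : 27 ≠ 0))]
  · have hc' : ¬ 29 ∣ c ^ 27 := fun h => hc (hp.dvd_of_dvd_pow h)
    simp only [RingHom.comp_apply, sgh_zeta hζ hc, map_pow, sgh_zeta hζ hc', RingHom.id_apply]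
    rw [← pow_mul, ← pow_succ', ← pow_mod29 hζ.pow_eq_one, fermat29 hc, pow_one]

/-- the automorphism ζ ↦ ζ^c -/
noncomputable def sg (hζ : IsPrimitiveRoot ζ 29) (c : ℕ) : 𝓞 K ≃+* 𝓞 K :=
  RingEquiv.ofRingHom (sgh hζ c) (sgh hζ (c ^ 27)) (sgh_inv' hζ c) (sgh_inv hζ c)

theorem sg_zeta (hζ : IsPrimitiveRoot ζ 29) {c : ℕ} (hc : ¬ 29 ∣ c) : sg hζ c ζ = ζ ^ c :=
  sgh_zeta hζ hc

theorem equiv_ext29 (hζ : IsPrimitiveRoot ζ 29) {f g : 𝓞 K ≃+* 𝓞 K}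
    (h : f ζ = g ζ) : f = g := by
  have := hom_ext29 hζ (f := f.toRingHom) (g := g.toRingHom) h
  ext x
  rw [show f x = g x from DFunLike.congr_fun this x]

theorem sg_mul (hζ : IsPrimitiveRoot ζ 29) {a b c : ℕ} (ha : ¬ 29 ∣ a) (hb : ¬ 29 ∣ b)
    (h : a * b % 29 = c % 29) : (sg hζ b).trans (sg hζ a) = sg hζ c := by
  apply equiv_ext29 hζ
  have hp : Nat.Prime 29 := by norm_num
  have hc : ¬ 29 ∣ c := by
    intro hc
    have : 29 ∣ a * b := by omega
    rcases (hp.dvd_mul).mp this with h | h <;> contradiction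
  rw [RingEquiv.trans_apply, sg_zeta hζ hb, map_pow, sg_zeta hζ ha, sg_zeta hζ hc, ← pow_mul,
    ← pow_mod29 hζ.pow_eq_one, h, pow_mod29 hζ.pow_eq_one]

theorem sg_sg (hζ : IsPrimitiveRoot ζ 29) {a b c : ℕ} (ha : ¬ 29 ∣ a) (hb : ¬ 29 ∣ b)
    (h : a * b % 29 = c % 29) (x : 𝓞 K) : sg hζ a (sg hζ b x) = sg hζ c x := by
  rw [← sg_mul hζ ha hb h]; rfl

theorem sg_one (hζ : IsPrimitiveRoot ζ 29) (x : 𝓞 K) : sg hζ 1 x = x := by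
  have : sg hζ 1 = RingEquiv.refl _ := equiv_ext29 hζ (by
    rw [sg_zeta hζ (by norm_num), pow_one]; rfl)
  rw [this]; rfl

theorem sg_congr (hζ : IsPrimitiveRoot ζ 29) {a b : ℕ} (ha : ¬ 29 ∣ a) (h : a % 29 = b % 29) :
    sg hζ a = sg hζ b := by
  apply equiv_ext29 hζ
  have hb : ¬ 29 ∣ b := by omega
  rw [sg_zeta hζ ha, sg_zeta hζ hb, ← pow_mod29 hζ.pow_eq_one, h, pow_mod29 hζ.pow_eq_one]

/-- complex conjugation -/
noncomputable def cj (hζ : IsPrimitiveRoot ζ 29) : 𝓞 K ≃+* 𝓞 K := sg hζ 28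

theorem cj_zeta (hζ : IsPrimitiveRoot ζ 29) : cj hζ ζ * ζ = 1 := by
  rw [cj, sg_zeta hζ (by norm_num), ← pow_succ, hζ.pow_eq_one]

theorem cj_cj (hζ : IsPrimitiveRoot ζ 29) (x : 𝓞 K) : cj hζ (cj hζ x) = x := by
  rw [cj, sg_sg hζ (c := 1) (by norm_num) (by norm_num) (by norm_num), sg_one]

theorem cj_sg (hζ : IsPrimitiveRoot ζ 29) {c : ℕ} (hc : ¬ 29 ∣ c) (x : 𝓞 K) :
    cj hζ (sg hζ c x) = sg hζ c (cj hζ x) := by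
  rw [cj, sg_sg hζ (c := 28 * c) (by norm_num) hc rfl,
    sg_sg hζ (c := 28 * c) hc (by norm_num) (by rw [mul_comm])]

open scoped Classical in
theorem norm29_prod (hζ : IsPrimitiveRoot ζ 29) (x : 𝓞 K) :
    ((Algebra.norm ℤ x : ℤ) : 𝓞 K) = ∏ c ∈ Finset.Icc 1 28, sg hζ c x := by
  have : IsGalois ℚ K := IsCyclotomicExtension.isGalois {29} ℚ K
  have hp : Fact (Nat.Prime 29) := ⟨by norm_num⟩
  have h1 : ((Algebra.norm ℤ x : ℤ) : 𝓞 K) = ∏ s : Gal(K/ℚ), s • x := by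
    apply FaithfulSMul.algebraMap_injective (𝓞 K) K
    rw [map_prod]
    have h2 := Algebra.norm_eq_prod_automorphisms ℚ (x : K)
    rw [← Algebra.coe_norm_int] at h2
    simp only [map_intCast, eq_ratCast, Rat.cast_intCast] at h2 ⊢
    exact h2
  rw [h1]
  have h3 : ∀ s : Gal(K/ℚ), s • x =
      sg hζ (IsCyclotomicExtension.Rat.galEquivZMod 29 K s).val.val x := by
    intro s
    have h4 : MulSemiringAction.toRingHom _ (𝓞 K) s =
        (sg hζ (IsCyclotomicExtension.Rat.galEquivZMod 29 K s).val.val).toRingHom := by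
      apply hom_ext29 hζ
      have hu := (IsCyclotomicExtension.Rat.galEquivZMod 29 K s).ne_zero
      have : ¬ 29 ∣ (IsCyclotomicExtension.Rat.galEquivZMod 29 K s).val.val := by
        intro h
        apply hu
        have := (ZMod.natCast_eq_zero_iff _ 29).mpr h
        rwa [ZMod.natCast_zmod_val] at this
      refine (IsCyclotomicExtension.Rat.galEquivZMod_smul_of_pow_eq 29 K s hζ.pow_eq_one).trans ?_
      exact (sg_zeta hζ this).symm
    exact DFunLike.congr_fun h4 x
  rw [Finset.prod_congr rfl (fun s _ => h3 s)]
  refine (Fintype.prod_equiv (IsCyclotomicExtension.Rat.galEquivZMod 29 K).toEquiv _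
    (fun u : (ZMod 29)ˣ => sg hζ u.val.val x) (fun s => rfl)).trans ?_
  refine Finset.prod_bij (fun u _ => u.val.val) ?_ ?_ ?_ ?_
  · intro u _
    have h5 : u.val.val ≠ 0 := by
      rw [Ne, ZMod.val_eq_zero]; exact u.ne_zero
    have := ZMod.val_lt u.val
    simp only [Finset.mem_Icc]; omega
  · intro u _ v _ h
    exact Units.ext (ZMod.val_injective _ h)
  · intro b hb
    simp only [Finset.mem_Icc] at hb
    have : Nat.Coprime b 29 := by
      refine ((Nat.Prime.coprime_iff_not_dvd hp.out).mpr ?_).symm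
      omega
    refine ⟨ZMod.unitOfCoprime b this, Finset.mem_univ _, ?_⟩
    rw [ZMod.coe_unitOfCoprime, ZMod.val_natCast, Nat.mod_eq_of_lt (by omega)]
  · intros; rfl

end P1

section P2
set_option linter.unusedSectionVars false
variable {K : Type} [Field K] [NumberField K] [IsCyclotomicExtension {(29 : ℕ)} ℚ K]
  {ζ : 𝓞 K}

/-- evaluation of a sparse integer polynomial -/
def ev {R : Type*} [Ring R] (t : ℕ → R) : List (ℤ × ℕ) → R
  | [] => 0
  | p :: l => (p.1 : R) * t p.2 + ev t l

def wt : List (ℤ × ℕ) → ℕ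
  | [] => 0
  | p :: l => p.1.natAbs + wt l

theorem map_ev {R S : Type*} [Ring R] [Ring S] (f : R →+* S) (t : ℕ → R) (l : List (ℤ × ℕ)) :
    f (ev t l) = ev (fun k => f (t k)) l := by
  induction l with
  | nil => simp [ev]
  | cons p l ih => simp [ev, ih]

theorem norm_ev_le (t : ℕ → ℂ) (ht : ∀ k, ‖t k‖ ≤ 1) (l : List (ℤ × ℕ)) :
    ‖ev t l‖ ≤ wt l := by
  induction l with
  | nil => simp [ev, wt]
  | cons p l ih =>
    simp only [ev, wt]
    push_cast
    refine (norm_add_le _ _).trans (add_le_add ?_ ih)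
    rw [norm_mul]
    have : ‖(p.1 : ℂ)‖ = (p.1.natAbs : ℝ) := by
      rw [Complex.norm_intCast, Nat.cast_natAbs, Int.cast_abs]
    rw [this]
    exact mul_le_of_le_one_right (by positivity) (ht _)

theorem exists_emb (hζ : IsPrimitiveRoot ζ 29) {j : ℕ} (hj : ¬ 29 ∣ j) :
    ∃ f : 𝓞 K →+* ℂ, f ζ = Complex.exp (2 * Real.pi * Complex.I / 29) ^ j := by
  have h := Complex.isPrimitiveRoot_exp 29 (by norm_num)
  apply exists_hom hζ
  apply geom29
  · rw [← pow_mul, mul_comm j, pow_mul]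
    have := h.pow_eq_one
    push_cast at this
    rw [this, one_pow]
  · intro h1
    have h2 := h.dvd_of_pow_eq_one j (by push_cast; exact h1)
    exact hj h2

theorem norm_bound (hζ : IsPrimitiveRoot ζ 29) (l : List (ℤ × ℕ)) :
    |Algebra.norm ℤ (ev (fun k => ζ ^ k) l)| ≤ (wt l : ℤ) ^ 28 := by
  obtain ⟨f, -⟩ := exists_emb hζ (j := 1) (by norm_num)
  have h := congrArg (fun x => ‖f x‖) (norm29_prod hζ (ev (fun k => ζ ^ k) l))
  simp only [map_intCast, map_prod, norm_prod] at h
  rw [Complex.norm_intCast] at h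
  have h2 : ∏ c ∈ Finset.Icc 1 28, ‖f (sg hζ c (ev (fun k => ζ ^ k) l))‖ ≤
      ∏ c ∈ Finset.Icc 1 28, (wt l : ℝ) := by
    apply Finset.prod_le_prod
    · intros; positivity
    · intro c _
      have := map_ev (f.comp (sg hζ c).toRingHom) (fun k => ζ ^ k) l
      change f (sg hζ c _) = _ at this
      rw [this]
      apply norm_ev_le
      intro k
      have : ‖(f.comp (sg hζ c).toRingHom) ζ‖ = 1 := by
        apply Complex.norm_eq_one_of_pow_eq_one (n := 29) _ (by norm_num)
        rw [← map_pow, hζ.pow_eq_one, map_one]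
      rw [map_pow, norm_pow, this, one_pow]
  rw [Finset.prod_const, Nat.card_Icc] at h2
  rw [← h] at h2
  exact_mod_cast h2

def ell : ℕ := (32 ^ 29 - 1) / 31

def pm (l : List (ℤ × ℕ)) : ℕ → ℤ
  | 0 => 1
  | n + 1 => (pm l n * ev (fun k => ((32 ^ (((n + 1) * k) % 29) : ℕ) : ℤ)) l) % (ell : ℤ)

def nck (l : List (ℤ × ℕ)) (m : ℤ) : Bool :=
  decide ((pm l 28 - m) % (ell : ℤ) = 0) && decide ((wt l) ^ 28 + m.natAbs < ell)

theorem norm_ev (hζ : IsPrimitiveRoot ζ 29) {l : List (ℤ × ℕ)} {m : ℤ} (h : nck l m = true) :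
    Algebra.norm ℤ (ev (fun k => ζ ^ k) l) = m := by
  simp only [nck, Bool.and_eq_true, decide_eq_true_eq] at h
  obtain ⟨h1, h2⟩ := h
  have h29 : (32 : ZMod ell) ^ 29 = 1 := by
    have : ((32 ^ 29 : ℕ) : ZMod ell) = ((1 : ℕ) : ZMod ell) := by
      rw [ZMod.natCast_eq_natCast_iff]; decide +kernel
    exact_mod_cast this
  obtain ⟨f, hf⟩ := exists_hom hζ (R := ZMod ell) 32 (by
    have : ((∑ i ∈ Finset.range 29, 32 ^ i : ℕ) : ZMod ell) = 0 := by
      rw [ZMod.natCast_eq_zero_iff]; decide +kernel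
    exact_mod_cast this)
  have h3 := congrArg f (norm29_prod hζ (ev (fun k => ζ ^ k) l))
  rw [map_prod, map_intCast] at h3
  have h4 : ∀ n ≤ 28, ((pm l n : ℤ) : ZMod ell) =
      ∏ c ∈ Finset.Icc 1 n, f (sg hζ c (ev (fun k => ζ ^ k) l)) := by
    intro n hn
    induction n with
    | zero => simp [pm]
    | succ n ih =>
      rw [Finset.prod_Icc_succ_top (by omega), ← ih (by omega), pm, ZMod.intCast_mod, Int.cast_mul]
      congr 1
      have h5 := map_ev (f.comp (sg hζ (n + 1)).toRingHom) (fun k => ζ ^ k) l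
      change f (sg hζ (n + 1) _) = _ at h5
      rw [h5]
      refine (map_ev (Int.castRingHom (ZMod ell)) _ l).trans ?_
      congr 1
      ext k
      have h6 : (f.comp (sg hζ (n + 1)).toRingHom) ζ = 32 ^ (n + 1) := by
        change f (sg hζ (n + 1) ζ) = _
        rw [sg_zeta hζ (by omega), map_pow, hf]
      rw [map_pow, h6, ← pow_mul, ← pow_mod29 h29]
      simp
  rw [← h4 28 le_rfl] at h3
  have h7 : (ell : ℤ) ∣ Algebra.norm ℤ (ev (fun k => ζ ^ k) l) - m := by
    have : ((pm l 28 : ℤ) : ZMod ell) = (m : ZMod ell) := by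
      rw [ZMod.intCast_eq_intCast_iff]
      exact (Int.emod_eq_emod_iff_emod_sub_eq_zero.mpr h1)
    rw [this, ZMod.intCast_eq_intCast_iff_dvd_sub] at h3
    rw [← dvd_neg, neg_sub]; exact h3
  have h8 := norm_bound hζ l
  have h9 : |Algebra.norm ℤ (ev (fun k => ζ ^ k) l) - m| < ell := by
    refine (abs_sub _ _).trans_lt ?_
    have : |m| = m.natAbs := by rw [Nat.cast_natAbs]; simp
    have h2' : ((wt l : ℤ)) ^ 28 + m.natAbs < ell := by exact_mod_cast h2
    rw [this]; linarith
  exact sub_eq_zero.mp (Int.eq_zero_of_abs_lt_dvd h7 h9)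

theorem prod_half (hζ : IsPrimitiveRoot ζ 29) {x : 𝓞 K} (hx : cj hζ x = x) :
    ((Algebra.norm ℤ x : ℤ) : 𝓞 K) = (∏ c ∈ Finset.Icc 1 14, sg hζ c x) ^ 2 := by
  rw [norm29_prod hζ]
  have : Finset.Icc 1 28 = Finset.Icc 1 14 ∪ (Finset.Icc 1 14).image (fun c => 29 - c) := by decide
  rw [this, Finset.prod_union (by decide), Finset.prod_image (by decide), sq]
  congr 1
  apply Finset.prod_congr rfl
  intro c hc
  rw [Finset.mem_Icc] at hc
  conv_rhs => rw [← hx, cj, sg_sg hζ (c := 29 - c) (by omega) (by norm_num) (by omega)]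

theorem prod_half_eq (hζ : IsPrimitiveRoot ζ 29) {x : 𝓞 K} (hx : cj hζ x = x) {m : ℤ}
    (hm : Algebra.norm ℤ x = m ^ 2) :
    ∏ c ∈ Finset.Icc 1 14, sg hζ c x = m ∨ ∏ c ∈ Finset.Icc 1 14, sg hζ c x = -m := by
  have := prod_half hζ hx
  rw [hm] at this
  push_cast at this
  exact sq_eq_sq_iff_eq_or_eq_neg.mp this.symm

theorem norm_sg (hζ : IsPrimitiveRoot ζ 29) {c : ℕ} (hc : ¬ 29 ∣ c) (x : 𝓞 K) :
    Algebra.norm ℤ (sg hζ c x) = Algebra.norm ℤ x := by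
  have := Algebra.norm_eq_of_algEquiv (R := ℤ) (AlgEquiv.ofRingEquiv (f := sg hζ c) (by simp) : 𝓞 K ≃ₐ[ℤ] 𝓞 K) x
  exact this


end P2

section P3
set_option linter.unusedSectionVars false
variable {K : Type} [Field K] [NumberField K] [IsCyclotomicExtension {(29 : ℕ)} ℚ K]
  {ζ : 𝓞 K}

def dec : ℕ → ℕ → ℕ → List (ℤ × ℕ)
  | 0, _, _ => []
  | n + 1, k, c =>
    if c % 3 = 1 then (1, k) :: (1, 29 - k) :: dec n (k + 1) (c / 3)
    else if c % 3 = 2 then (-1, k) :: (-1, 29 - k) :: dec n (k + 1) (c / 3)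
    else dec n (k + 1) (c / 3)

theorem cj_zeta_pow (hζ : IsPrimitiveRoot ζ 29) {k : ℕ} (hk : k ≤ 29) :
    cj hζ (ζ ^ k) = ζ ^ (29 - k) := by
  have h1 : cj hζ (ζ ^ k) * ζ ^ k = 1 := by
    rw [map_pow, ← mul_pow, cj_zeta, one_pow]
  have h2 : ζ ^ (29 - k) * ζ ^ k = 1 := by
    rw [← pow_add, Nat.sub_add_cancel hk, hζ.pow_eq_one]
  have h3 : ζ ^ k ≠ 0 := fun h => by rw [h, mul_zero] at h2; exact zero_ne_one h2
  exact mul_right_cancel₀ h3 (h1.trans h2.symm)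

theorem cj_dec (hζ : IsPrimitiveRoot ζ 29) (n k c : ℕ) (h : k + n ≤ 29) :
    cj hζ (ev (fun k => ζ ^ k) (dec n k c)) = ev (fun k => ζ ^ k) (dec n k c) := by
  induction n generalizing k c with
  | zero => simp [dec, ev]
  | succ n ih =>
    have e : 29 - (29 - k) = k := by omega
    have := ih (k + 1) (c / 3) (by omega)
    rw [dec]
    split_ifs
    · simp only [ev, map_add, map_mul, this, map_intCast, cj_zeta_pow hζ (show k ≤ 29 by omega),
        cj_zeta_pow hζ (show 29 - k ≤ 29 by omega), e]
      ring
    · simp only [ev, map_add, map_mul, this, map_intCast, cj_zeta_pow hζ (show k ≤ 29 by omega),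
        cj_zeta_pow hζ (show 29 - k ≤ 29 by omega), e]
      ring
    · exact this

def tbl : List (ℕ × ℕ) := [
  (29, 5), (59, 37), (173, 86), (233, 118), (289, 14), (347, 102), (349, 34), (463, 275), (521,
  137), (523, 35), (811, 103), (929, 283), (1103, 47), (1217, 123), (1277, 425), (1451, 347),
  (1567, 41), (1681, 125), (1741, 89), (1913, 1229), (1973, 93), (2029, 262), (2087, 371), (2089,
  1126), (2203, 837), (2377, 1163), (2437, 141), (2551, 341), (2609, 768), (2843, 38), (2957,
  1417), (3191, 265), (3307, 1009), (3539, 1189), (3769, 1206), (3943, 885), (4001, 383), (4003,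
  126), (4177, 131), (4349, 953), (4409, 482), (4523, 319), (4583, 467), (4639, 43), (4813, 421),
  (4871, 2253), (4931, 1014), (4987, 1033), (5279, 160), (5393, 49), (5569, 2946), (5683, 17),
  (5741, 387), (5743, 1456), (5801, 3628), (5857, 3545), (6089, 2287), (6091, 1307), (6263, 139),
  (6323, 284), (6379, 1190), (6553, 1144), (6959, 773), (6961, 867), (7019, 391), (7193, 751),
  (7307, 2599), (7309, 3218), (7481, 1253), (7541, 2489), (7829, 2494), (8179, 155), (8237, 1208),
  (8293, 415), (8353, 291), (8467, 1316), (8527, 3626), (8641, 2527), (8699, 472), (8933, 158),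
  (9049, 926), (9221, 755), (9281, 402), (9337, 3928), (9397, 1166), (9511, 928), (9629, 1180),
  (9743, 2738), (9803, 1266), (9859, 285), (10091, 427), (10093, 3818), (10151, 466), (10267,
  1407), (10499, 477), (10613, 3800), (10729, 295), (10789, 409), (10847, 1335), (10903, 2525),
  (11251, 3118), (11311, 8730), (11369, 8111), (11483, 437), (11657, 2545), (11717, 3917), (11831,
  1037), (11833, 1439), (12007, 101), (12239, 3984), (12413, 4159), (12527, 3265), (12703, 851),
  (13049, 7868), (13109, 445), (13339, 3352), (13397, 2389), (13399, 3002), (13457, 2314), (13513,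
  3350), (13687, 483), (13921, 3082), (14153, 8302), (14327, 1095), (14557, 1173), (14731, 2456),
  (15137, 3042), (15139, 1375), (15313, 2845), (15427, 1446), (15601, 3826), (15661, 4072),
  (16007, 7923), (16067, 3033), (16183, 7142), (16529, 947), (16703, 2748), (16763, 3396), (16879,
  2330), (16937, 320), (16993, 296), (17053, 1240), (17167, 329), (17341, 454), (17401, 3243),
  (17573, 2879), (17747, 7749), (17749, 2898), (17807, 1453), (17863, 9350), (17921, 4162),
  (17923, 886), (17981, 2762), (18097, 7577), (18211, 8304), (18269, 2546), (18329, 3698), (18443,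
  6740), (18503, 20382), (18617, 1047), (18793, 3315), (19081, 9296), (19139, 2505), (19141,
  2710), (19373, 19805), (19429, 2508), (19489, 8143), (19603, 3322), (19661, 3077), (19777,
  1387), (20011, 11901), (20183, 7666), (20357, 2967), (20359, 3557), (20533, 8294), (20707,
  2533), (20879, 3003), (20939, 761), (21169, 2719), (21227, 6921), (21401, 8288), (21517, 24670),
  (21577, 10645), (21751, 1042), (22039, 2629), (22157, 6996), (22271, 2387), (22273, 3073),
  (22447, 1339), (22619, 4036), (22621, 2994), (22679, 3676), (22853, 8826), (23027, 11265),
  (23143, 8384), (23201, 3306), (23431, 444), (23549, 3335), (23663, 855), (24071, 7885), (24359,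
  3590), (24419, 3371), (24533, 1128), (24593, 9846), (24649, 9066), (24709, 3908), (24767, 9703),
  (25057, 3452)]

theorem tbl_ok : tbl.all (fun p => nck (dec 10 1 p.2) ((p.1 : ℤ) ^ 2)) = true := by
  decide +kernel

def inT (m : ℕ) : Bool := m == 16384 || tbl.any (fun p => p.1 == m)

theorem inT_spec (hζ : IsPrimitiveRoot ζ 29) {m : ℕ} (h : inT m = true) :
    ∃ α : 𝓞 K, cj hζ α = α ∧ Algebra.norm ℤ α = (m : ℤ) ^ 2 := by
  simp only [inT, Bool.or_eq_true, beq_iff_eq, List.any_eq_true] at h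
  rcases h with h | ⟨p, hp, h⟩
  · refine ⟨((2 : ℤ) : 𝓞 K), map_intCast _ _, ?_⟩
    have h1 : Algebra.norm ℤ (ev (fun k => ζ ^ k) [(2, 0)]) = 2 ^ 28 :=
      norm_ev hζ (by decide +kernel)
    simp only [ev, pow_zero, mul_one, add_zero] at h1
    rw [h1, h]; norm_num
  · refine ⟨_, cj_dec hζ 10 1 p.2 (by norm_num), ?_⟩
    rw [← h]
    exact norm_ev hζ (List.all_eq_true.mp tbl_ok p hp)

def okd (m : ℕ) : List ℕ → Bool
  | [] => inT m
  | d :: l => bif Nat.beq (m % d) 0 then (!(Nat.beq (d ^ 20 % m) 0) || inT d || okd m l)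
    else okd m l

def prs : List ℕ := [2, 3, 5, 7, 11, 13, 17, 19, 23, 29, 31, 37, 41, 43, 47, 53, 59, 61, 67, 71, 73,
  79, 83, 89, 97, 101, 103, 107, 109, 113, 127, 131, 137, 139, 149, 151, 157]

def allk : ℕ → Bool
  | 0 => true
  | n + 1 => (okd (29 * n + 30) prs) && (okd (29 * n + 28) prs) && allk n

theorem allk_ok : allk 867 = true := by decide +kernel

theorem okd_spec {m : ℕ} (hm : IsPrimePow m) (hm2 : m < 2 ^ 20) (l : List ℕ) (hl : ∀ d ∈ l, 1 < d)
    (h : okd m l = true) : ∃ d, 1 < d ∧ d ∣ m ∧ inT d = true := by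
  induction l with
  | nil => exact ⟨m, hm.one_lt, dvd_rfl, h⟩
  | cons d l ih =>
    have ih' := ih (fun x hx => hl x (List.mem_cons_of_mem _ hx))
    have hd := hl d List.mem_cons_self
    rw [okd] at h
    rcases hb : Nat.beq (m % d) 0
    · rw [hb] at h; exact ih' h
    · rw [hb] at h
      simp only [cond_true, Bool.or_eq_true, Bool.not_eq_true'] at h
      have hdm : d ∣ m := Nat.dvd_of_mod_eq_zero (Nat.eq_of_beq_eq_true hb)
      rcases h with (h | h) | h
      · exfalso
        obtain ⟨p, k, hp, hk, rfl⟩ := (isPrimePow_nat_iff m).mp hm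
        obtain ⟨i, hi, rfl⟩ := (Nat.dvd_prime_pow hp).mp hdm
        have hi0 : i ≠ 0 := by rintro rfl; simp at hd
        have hk20 : k < 20 := by
          have h3 : 2 ^ k < 2 ^ 20 := lt_of_le_of_lt (Nat.pow_le_pow_left hp.two_le k) hm2
          exact (Nat.pow_lt_pow_iff_right (by norm_num)).mp h3
        have : (p ^ i) ^ 20 % p ^ k = 0 := by
          apply Nat.mod_eq_zero_of_dvd
          rw [← pow_mul]
          apply pow_dvd_pow
          have : 1 ≤ i := Nat.one_le_iff_ne_zero.mpr hi0
          omega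
        rw [this] at h
        exact absurd h (by decide)
      · exact ⟨d, hd, hdm, h⟩
      · exact ih' h

theorem allk_spec {N : ℕ} (h : allk N = true) {n : ℕ} (hn : n < N) :
    okd (29 * n + 30) prs = true ∧ okd (29 * n + 28) prs = true := by
  induction N with
  | zero => omega
  | succ N ih =>
    simp only [allk, Bool.and_eq_true] at h
    rcases Nat.lt_succ_iff_lt_or_eq.mp hn with h1 | rfl
    · exact ih h.2 h1
    · exact h.1

theorem table_main (hζ : IsPrimitiveRoot ζ 29) {m : ℕ} (hm : IsPrimePow m) (hm2 : m ≤ 25130)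
    (hm3 : m % 29 = 0 ∨ m % 29 = 1 ∨ m % 29 = 28) :
    ∃ d : ℕ, 1 < d ∧ d ∣ m ∧ ∃ α : 𝓞 K, cj hζ α = α ∧ Algebra.norm ℤ α = (d : ℤ) ^ 2 := by
  have h1 := hm.one_lt
  suffices ∃ d, 1 < d ∧ d ∣ m ∧ inT d = true by
    obtain ⟨d, a, b, c⟩ := this
    exact ⟨d, a, b, inT_spec hζ c⟩
  have hp : ∀ d ∈ prs, 1 < d := by decide
  rcases hm3 with h | h | h
  · exact ⟨29, by norm_num, Nat.dvd_of_mod_eq_zero h, by decide +kernel⟩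
  · apply okd_spec hm (by omega) prs hp
    have := (allk_spec allk_ok (n := m / 29 - 1) (by omega)).1
    rwa [show 29 * (m / 29 - 1) + 30 = m by omega] at this
  · apply okd_spec hm (by omega) prs hp
    have := (allk_spec allk_ok (n := m / 29) (by omega)).2
    rwa [show 29 * (m / 29) + 28 = m by omega] at this

end P3

section P4
set_option linter.unusedSectionVars false

theorem ideal_eq_of_le {F : Type*} [Field F] [NumberField F] {I J : Ideal (𝓞 F)} (h : I ≤ J)
    (hI : I ≠ ⊥) (hn : Ideal.absNorm I ∣ Ideal.absNorm J) : I = J := by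
  obtain ⟨L, hL⟩ := Ideal.dvd_iff_le.mpr h
  have h0 : Ideal.absNorm I ≠ 0 := by rwa [Ne, Ideal.absNorm_eq_zero_iff]
  have h1 := Nat.dvd_antisymm hn (Ideal.absNorm_dvd_absNorm_of_le h)
  have h2 : Ideal.absNorm I = Ideal.absNorm J * Ideal.absNorm L := by rw [hL, map_mul]
  rw [← h1] at h2
  have h3 : Ideal.absNorm L = 1 := by
    have : Ideal.absNorm I * 1 = Ideal.absNorm I * Ideal.absNorm L := by rw [mul_one]; exact h2
    exact (mul_left_cancel₀ h0 this).symm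
  rw [Ideal.absNorm_eq_one_iff] at h3
  rw [hL, h3, Ideal.mul_top]

variable {K : Type} [Field K] [NumberField K] [IsCyclotomicExtension {(29 : ℕ)} ℚ K]
  {ζ : 𝓞 K}

instance cm29 : IsCMField K := IsCyclotomicExtension.Rat.isCMField K (S := {29}) ⟨29, rfl, by norm_num⟩

local notation "Kp" => maximalRealSubfield K

theorem rcc_eq (hζ : IsPrimitiveRoot ζ 29) (x : 𝓞 K) :
    IsCMField.ringOfIntegersComplexConj K x = cj hζ x := by
  have h : (IsCMField.ringOfIntegersComplexConj K).toRingEquiv = cj hζ := by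
    apply equiv_ext29 hζ
    have hz : ζ ≠ 0 := hζ.ne_zero (by norm_num)
    apply mul_right_cancel₀ hz
    rw [cj_zeta]
    let u : NumberField.Units.torsion K := ⟨hζ.toRootsOfUnity.val, by
      change _ ∈ CommGroup.torsion _
      rw [CommGroup.mem_torsion, isOfFinOrder_iff_pow_eq_one]
      exact ⟨29, by norm_num, (mem_rootsOfUnity _ _).mp hζ.toRootsOfUnity.2⟩⟩
    have h1 := IsCMField.complexConj_torsion K u
    have h2 : ((u.val : (𝓞 K)ˣ) : 𝓞 K) = ζ := rfl
    apply RingOfIntegers.ext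
    change IsCMField.complexConj K (ζ : K) * (ζ : K) = 1
    have h3 : IsCMField.complexConj K (ζ : K) = (ζ : K)⁻¹ := h1
    rw [h3]
    apply inv_mul_cancel₀
    exact_mod_cast hz
  exact DFunLike.congr_fun h x

theorem real_iff (hζ : IsPrimitiveRoot ζ 29) (x : 𝓞 K) :
    cj hζ x = x ↔ ∃ y : 𝓞 Kp, algebraMap (𝓞 Kp) (𝓞 K) y = x := by
  rw [← rcc_eq hζ, IsCMField.ringOfIntegersComplexConj_eq_self_iff]
  rfl

theorem cj_algebraMap (hζ : IsPrimitiveRoot ζ 29) (y : 𝓞 Kp) :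
    cj hζ (algebraMap (𝓞 Kp) (𝓞 K) y) = algebraMap (𝓞 Kp) (𝓞 K) y :=
  (real_iff hζ _).mpr ⟨y, rfl⟩

theorem finrank29 : Module.finrank ℚ K = 28 := by
  rw [IsCyclotomicExtension.finrank K (Polynomial.cyclotomic.irreducible_rat (by norm_num : 0 < 29))]
  decide

theorem finrank2 : Module.finrank Kp K = 2 := Algebra.IsQuadraticExtension.finrank_eq_two _ K

theorem finrank2' : Module.finrank (𝓞 Kp) (𝓞 K) = 2 := by
  rw [← finrank2 (K := K)]
  exact (IsFractionRing.finrank_eq (𝓞 Kp) Kp (𝓞 K) K).symm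

theorem finrank14 : Module.finrank ℚ Kp = 14 := by
  have := Module.finrank_mul_finrank ℚ Kp K
  rw [finrank2, finrank29 (K := K)] at this
  omega

theorem absNorm_ext (I : Ideal (𝓞 Kp)) :
    Ideal.absNorm (I.map (algebraMap (𝓞 Kp) (𝓞 K))) = Ideal.absNorm I ^ 2 := by
  rw [Ideal.absNorm_algebraMap, finrank2']

theorem natAbs_discr29 : (NumberField.discr K).natAbs = 29 ^ 27 := by
  have : Fact (Nat.Prime 29) := ⟨by norm_num⟩
  rw [IsCyclotomicExtension.Rat.discr_prime 29 K]; norm_num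

theorem discr_le : |(NumberField.discr Kp : ℤ)| ≤ 29 ^ 13 := by
  have h := natAbs_discr_eq_absNorm_differentIdeal_mul_natAbs_discr_pow Kp (𝓞 Kp) K (𝓞 K)
  rw [natAbs_discr29, finrank2] at h
  have hd : (NumberField.discr Kp).natAbs ^ 2 ∣ 29 ^ 27 := ⟨_, by rw [h, mul_comm]⟩
  have h1 : (NumberField.discr Kp).natAbs ∣ 29 ^ 27 := (Dvd.intro_left _ (by rw [sq])).trans hd
  obtain ⟨k, hk, he⟩ := (Nat.dvd_prime_pow (by norm_num : Nat.Prime 29)).mp h1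
  rw [he, ← pow_mul, Nat.pow_dvd_pow_iff_le_right (by norm_num)] at hd
  rw [Int.abs_eq_natAbs, he]
  have : 29 ^ k ≤ 29 ^ 13 := Nat.pow_le_pow_right (by norm_num) (by omega)
  exact_mod_cast this


theorem mink_bound_p {x : ℕ} (hx : (x : ℝ) ≤ (4 / Real.pi) ^ InfinitePlace.nrComplexPlaces Kp *
    ((Module.finrank ℚ Kp).factorial / (Module.finrank ℚ Kp : ℝ) ^ (Module.finrank ℚ Kp) *
      Real.sqrt |(NumberField.discr Kp : ℝ)|)) : x ≤ 25130 := by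
  rw [IsTotallyReal.nrComplexPlaces_eq_zero, finrank14, pow_zero, one_mul] at hx
  have h1 : Real.sqrt |(NumberField.discr Kp : ℝ)| ≤ Real.sqrt (29 ^ 13) := by
    apply Real.sqrt_le_sqrt
    exact_mod_cast (discr_le (K := K))
  have h2 : Real.sqrt (29 ^ 13) ≤ 3203222000 := by
    rw [Real.sqrt_le_left (by norm_num)]; norm_num
  have h3 : ((14 : ℕ).factorial : ℝ) / ((14 : ℕ) : ℝ) ^ 14 *
      Real.sqrt |(NumberField.discr Kp : ℝ)| ≤
      ((14 : ℕ).factorial : ℝ) / ((14 : ℕ) : ℝ) ^ 14 * 3203222000 :=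
    mul_le_mul_of_nonneg_left (h1.trans h2) (by positivity)
  have h4 : ((14 : ℕ).factorial : ℝ) / ((14 : ℕ) : ℝ) ^ 14 * 3203222000 < 25131 := by
    norm_num [Nat.factorial]
  have : (x : ℝ) < (25131 : ℕ) := by push_cast; linarith
  have := Nat.cast_lt.mp this
  omega

end P4

section P5
set_option linter.unusedSectionVars false
set_option linter.style.haveILetI false
set_option linter.unusedVariables false
variable {K : Type} [Field K] [NumberField K] [IsCyclotomicExtension {(29 : ℕ)} ℚ K]
  {ζ : 𝓞 K}
local notation "Kp" => maximalRealSubfield K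

/-- ζ^k ≡ 1 mod a proper prime ideal not containing 29 forces 29 ∣ k -/
theorem zeta_pow_mem (hζ : IsPrimitiveRoot ζ 29) {Q : Ideal (𝓞 K)} [hQ : Q.IsPrime]
    (h29 : (29 : 𝓞 K) ∉ Q) {k : ℕ} (hk : ζ ^ k - 1 ∈ Q) : 29 ∣ k := by
  by_contra h
  -- in the quotient w = ζ^k = 1, but Σ w^i = 0
  have h1 : ∑ i ∈ Finset.range 29, (ζ ^ k) ^ i = 0 := by
    apply geom29
    · rw [← pow_mul, mul_comm, pow_mul, hζ.pow_eq_one, one_pow]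
    · intro h1; exact h (hζ.dvd_of_pow_eq_one k h1)
  apply h29
  have h2 := congrArg (Ideal.Quotient.mk Q) h1
  have h3 : Ideal.Quotient.mk Q (ζ ^ k) = 1 := by
    rw [← map_one (Ideal.Quotient.mk Q)]; exact Ideal.Quotient.eq.mpr hk
  rw [map_sum] at h2
  simp only [map_pow _ (ζ ^ k), h3, one_pow, Finset.sum_const, Finset.card_range, map_zero] at h2
  rw [← Ideal.Quotient.eq_zero_iff_mem, ← h2]
  simp only [nsmul_eq_mul, mul_one]
  exact map_natCast (Ideal.Quotient.mk Q) 29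

theorem norm_mod (hζ : IsPrimitiveRoot ζ 29) {q : Ideal (𝓞 Kp)} [hq : q.IsPrime] (hq0 : q ≠ ⊥)
    (h29 : (29 : 𝓞 Kp) ∉ q) :
    Ideal.absNorm q % 29 = 1 ∨ Ideal.absNorm q % 29 = 28 := by
  have hqm := hq.isMaximal hq0
  obtain ⟨Q, hQm, hQ⟩ := Ideal.exists_maximal_ideal_liesOver_of_isIntegral (S := 𝓞 K) q
  have hQp : Q.IsPrime := hQm.isPrime
  have hqm := hq.isMaximal hq0
  have hmem : ∀ x : 𝓞 Kp, x ∈ q ↔ algebraMap (𝓞 Kp) (𝓞 K) x ∈ Q := fun x => by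
    rw [hQ.over, Ideal.mem_comap]
  have h29' : (29 : 𝓞 K) ∉ Q := by
    intro h; apply h29; rw [hmem]
    rw [show algebraMap (𝓞 Kp) (𝓞 K) 29 = 29 from map_ofNat _ 29]; exact h
  letI := Ideal.Quotient.field q
  have hfin : Finite (𝓞 Kp ⧸ q) := by
    rw [← Ideal.absNorm_ne_zero_iff, Ne, Ideal.absNorm_eq_zero_iff]; exact hq0
  letI := Fintype.ofFinite (𝓞 Kp ⧸ q)
  set m := Ideal.absNorm q with hm
  have hcard : Fintype.card (𝓞 Kp ⧸ q) = m := by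
    rw [hm, Ideal.absNorm_apply, Submodule.cardQuot_apply, Nat.card_eq_fintype_card]
  obtain ⟨t, ht⟩ := (real_iff hζ (ζ + cj hζ ζ)).mp (by rw [map_add, cj_cj, add_comm])
  have h1 : t ^ m - t ∈ q := by
    rw [← Ideal.Quotient.eq, map_pow, ← hcard]
    exact FiniteField.pow_card _
  have h2 := (hmem _).mp h1
  rw [map_sub, map_pow, ht] at h2
  -- char p
  obtain ⟨p, hp, n, hpp, hpn⟩ := FiniteField.card' (𝓞 Kp ⧸ q)
  have hpm : m = p ^ (n : ℕ) := by rw [← hcard, hpn]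
  have hpQ : CharP (𝓞 K ⧸ Q) p := by
    have : (p : 𝓞 K) ∈ Q := by
      have : (p : 𝓞 Kp) ∈ q := by
        rw [← Ideal.Quotient.eq_zero_iff_mem, map_natCast]; exact CharP.cast_eq_zero _ p
      rw [hmem] at this; simpa using this
    have h0 : ((p : ℕ) : 𝓞 K ⧸ Q) = 0 := by
      rw [← map_natCast (Ideal.Quotient.mk Q), Ideal.Quotient.eq_zero_iff_mem]; exact this
    exact (CharP.charP_iff_prime_eq_zero hpp).mpr h0
  have : Fact p.Prime := ⟨hpp⟩
  have : ExpChar (𝓞 K ⧸ Q) p := ExpChar.prime hpp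
  set z := Ideal.Quotient.mk Q ζ with hz
  set w := Ideal.Quotient.mk Q (cj hζ ζ) with hw
  have hzw : w * z = 1 := by rw [hz, hw, ← map_mul, cj_zeta, map_one]
  have h3 : z ^ m + w ^ m = z + w := by
    have := Ideal.Quotient.eq.mpr h2
    rw [map_pow, map_add, ← hz, ← hw, hpm, add_pow_expChar_pow] at this
    rw [hpm]; exact this
  have h4 : (z ^ m - z) * (z ^ (m + 1) - 1) = 0 := by
    have e : w ^ m * z ^ m = 1 := by rw [← mul_pow, hzw, one_pow]
    have : (z ^ m + w ^ m) * z ^ (m + 1) = (z + w) * z ^ (m + 1) := by rw [h3]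
    have e1 : w * z ^ (m + 1) = z ^ m := by rw [pow_succ']; linear_combination z ^ m * hzw
    have e2 : w ^ m * z ^ (m + 1) = z := by rw [pow_succ]; linear_combination z * e
    rw [add_mul, add_mul, e1, e2] at this
    rw [pow_succ] at *
    linear_combination this
  have hm1 : 1 ≤ m := by rw [hpm]; exact Nat.one_le_iff_ne_zero.mpr (pow_ne_zero _ hpp.ne_zero)
  rcases mul_eq_zero.mp h4 with h5 | h5
  · left
    have h6 : ζ ^ (m - 1) - 1 ∈ Q := by
      rw [← Ideal.Quotient.eq, map_pow, map_one, ← hz]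
      have : z * (z ^ (m - 1) - 1) = 0 := by
        rw [mul_sub, ← pow_succ', Nat.sub_add_cancel hm1, mul_one]; exact h5
      rcases mul_eq_zero.mp this with h | h
      · rw [h, mul_zero] at hzw; exact absurd hzw zero_ne_one
      · exact sub_eq_zero.mp h
    have := zeta_pow_mem hζ h29' h6
    omega
  · right
    have h6 : ζ ^ (m + 1) - 1 ∈ Q := by
      rw [← Ideal.Quotient.eq, map_pow, map_one, ← hz]
      exact sub_eq_zero.mp h5
    have := zeta_pow_mem hζ h29' h6
    omega

theorem norm_real (hζ : IsPrimitiveRoot ζ 29) (a : 𝓞 Kp) {d : ℕ}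
    (h : Algebra.norm ℤ (algebraMap (𝓞 Kp) (𝓞 K) a) = (d : ℤ) ^ 2) :
    Ideal.absNorm (Ideal.span {a}) = d := by
  have h1 := absNorm_ext (K := K) (Ideal.span {a})
  rw [Ideal.map_span, Set.image_singleton, Ideal.absNorm_span_singleton, h, Int.natAbs_pow,
    Int.natAbs_natCast] at h1
  exact (Nat.pow_left_injective (by norm_num : 2 ≠ 0) h1).symm

theorem pid_real (hζ : IsPrimitiveRoot ζ 29) : IsPrincipalIdealRing (𝓞 Kp) := by
  apply RingOfIntegers.isPrincipalIdealRing_of_isPrincipal_of_norm_le_of_isPrime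
  intro I hI hn
  have hb := mink_bound_p hn
  set q : Ideal (𝓞 Kp) := (I : Ideal (𝓞 Kp)) with hq
  have hq0 : q ≠ ⊥ := nonZeroDivisors.coe_ne_zero I
  have hqm := hI.isMaximal hq0
  have hN0 : Ideal.absNorm q ≠ 0 := by rwa [Ne, Ideal.absNorm_eq_zero_iff]
  have hpp : IsPrimePow (Ideal.absNorm q) := by
    letI := Ideal.Quotient.field q
    have hfin : Finite (𝓞 Kp ⧸ q) := by
      rwa [← Ideal.absNorm_ne_zero_iff]
    letI := Fintype.ofFinite (𝓞 Kp ⧸ q)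
    have := FiniteField.isPrimePow_card (𝓞 Kp ⧸ q)
    rwa [← Nat.card_eq_fintype_card, ← Submodule.cardQuot_apply, ← Ideal.absNorm_apply] at this
  have hmod : Ideal.absNorm q % 29 = 0 ∨ Ideal.absNorm q % 29 = 1 ∨ Ideal.absNorm q % 29 = 28 := by
    by_cases h29 : (29 : 𝓞 Kp) ∈ q
    · left
      have h1 := Ideal.absNorm_dvd_absNorm_of_le ((Ideal.span_singleton_le_iff_mem q).mpr h29)
      have h2 : Ideal.absNorm (Ideal.span {(29 : 𝓞 Kp)}) = 29 ^ 14 := by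
        have : (29 : 𝓞 Kp) = algebraMap ℤ (𝓞 Kp) 29 := by simp
        rw [this, Ideal.absNorm_span_singleton, Algebra.norm_algebraMap, RingOfIntegers.rank,
          finrank14]
        norm_num
      rw [h2] at h1
      obtain ⟨k, hk, he⟩ := (Nat.dvd_prime_pow (by norm_num : Nat.Prime 29)).mp h1
      have hk0 : k ≠ 0 := by
        rintro rfl
        exact hI.ne_top (Ideal.absNorm_eq_one_iff.mp (by simpa using he))
      rw [he]
      exact Nat.mod_eq_zero_of_dvd (dvd_pow_self _ hk0)
    · right; exact norm_mod hζ hq0 h29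
  obtain ⟨d, hd1, hdm, α, hα, hN⟩ := table_main hζ hpp hb hmod
  have hdq : (d : 𝓞 Kp) ∈ q := by
    -- q contains p, d is a nontrivial power of p
    obtain ⟨p, k, hp, hk, he⟩ := (isPrimePow_nat_iff _).mp hpp
    rw [← he] at hdm
    obtain ⟨i, hi, rfl⟩ := (Nat.dvd_prime_pow hp).mp hdm
    have hi0 : i ≠ 0 := by rintro rfl; simp at hd1
    have h1 := Ideal.absNorm_mem q
    rw [← he, Nat.cast_pow] at h1
    have h2 := hI.mem_of_pow_mem _ h1
    rw [Nat.cast_pow]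
    exact Ideal.pow_mem_of_mem _ h2 _ (Nat.pos_of_ne_zero hi0)
  have hreal : ∀ c ∈ Finset.Icc 1 14, ∃ a : 𝓞 Kp, algebraMap (𝓞 Kp) (𝓞 K) a = sg hζ c α := by
    intro c hc
    rw [Finset.mem_Icc] at hc
    rw [← real_iff hζ, cj_sg hζ (by omega), hα]
  choose! a ha using hreal
  have hprod : ∏ c ∈ Finset.Icc 1 14, a c ∈ q := by
    have hinj : Function.Injective (algebraMap (𝓞 Kp) (𝓞 K)) := FaithfulSMul.algebraMap_injective _ _
    have h1 : algebraMap (𝓞 Kp) (𝓞 K) (∏ c ∈ Finset.Icc 1 14, a c) =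
        ∏ c ∈ Finset.Icc 1 14, sg hζ c α := by
      rw [map_prod]; exact Finset.prod_congr rfl ha
    rcases prod_half_eq hζ hα hN with h | h
    · have : ∏ c ∈ Finset.Icc 1 14, a c = (d : 𝓞 Kp) := by
        apply hinj; rw [h1, h]; simp
      rw [this]; exact hdq
    · have : ∏ c ∈ Finset.Icc 1 14, a c = -(d : 𝓞 Kp) := by
        apply hinj; rw [h1, h]; simp
      rw [this]; exact neg_mem hdq
  obtain ⟨c, hc, hcq⟩ := (hI.prod_mem_iff).mp hprod
  have hna : Ideal.absNorm (Ideal.span {a c}) = d := by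
    apply norm_real hζ
    rw [ha c hc, norm_sg hζ (by rw [Finset.mem_Icc] at hc; omega), hN]
  have hle := (Ideal.span_singleton_le_iff_mem q).mpr hcq
  have : Ideal.span {a c} = q := by
    apply ideal_eq_of_le hle
    · intro h; rw [h, Ideal.absNorm_bot] at hna; omega
    · rw [hna]; exact hdm
  exact ⟨a c, by rw [← this]⟩

end P5

section P6
set_option linter.unusedSectionVars false
set_option linter.style.haveILetI false
set_option linter.unusedVariables false

section gen
variable {R : Type*} [CommRing R]

theorem mem_map_e (e : R ≃+* R) {I : Ideal R} {x : R} : x ∈ Ideal.map e I ↔ ∃ y ∈ I, e y = x := by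
  rw [Ideal.mem_map_of_equiv]

theorem map_e_mem (e : R ≃+* R) {I : Ideal R} {x : R} : e x ∈ Ideal.map e I ↔ x ∈ I := by
  rw [mem_map_e]
  exact ⟨fun ⟨y, hy, h⟩ => e.injective h ▸ hy, fun h => ⟨x, h, rfl⟩⟩

theorem map_e_span (e : R ≃+* R) (a : R) : Ideal.map e (Ideal.span {a}) = Ideal.span {e a} := by
  rw [Ideal.map_span, Set.image_singleton]

theorem map_e_inj (e : R ≃+* R) {I J : Ideal R} (h : Ideal.map e I = Ideal.map e J) : I = J := by
  ext x; rw [← map_e_mem e, h, map_e_mem]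

theorem map_e_comp {e f g : R ≃+* R} (h : ∀ x, e (f x) = g x) (I : Ideal R) :
    Ideal.map e (Ideal.map f I) = Ideal.map g I := by
  ext x
  rw [mem_map_e, mem_map_e]
  constructor
  · rintro ⟨y, hy, rfl⟩
    obtain ⟨z, hz, rfl⟩ := (mem_map_e f).mp hy
    exact ⟨z, hz, (h z).symm⟩
  · rintro ⟨z, hz, rfl⟩
    exact ⟨f z, (map_e_mem f).mpr hz, h z⟩

theorem map_e_ne_bot (e : R ≃+* R) {I : Ideal R} (h : I ≠ ⊥) : Ideal.map e I ≠ ⊥ := by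
  intro h1
  apply h
  apply map_e_inj e
  rw [h1, Ideal.map_bot]

theorem map_e_prime (e : R ≃+* R) {I : Ideal R} (h : I.IsPrime) : (Ideal.map e I).IsPrime :=
  Ideal.map_isPrime_of_equiv e

/-- principal -/
def Pr (I : Ideal R) : Prop := ∃ a, I = Ideal.span {a}

theorem Pr.mul {I J : Ideal R} (hI : Pr I) (hJ : Pr J) : Pr (I * J) := by
  obtain ⟨a, rfl⟩ := hI
  obtain ⟨b, rfl⟩ := hJ
  exact ⟨a * b, Ideal.span_singleton_mul_span_singleton a b⟩

theorem Pr.pow {I : Ideal R} (hI : Pr I) (n : ℕ) : Pr (I ^ n) := by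
  obtain ⟨a, rfl⟩ := hI
  exact ⟨a ^ n, Ideal.span_singleton_pow a n⟩

theorem Pr.map {I : Ideal R} (hI : Pr I) (e : R ≃+* R) : Pr (Ideal.map e I) := by
  obtain ⟨a, rfl⟩ := hI
  exact ⟨e a, map_e_span e a⟩

theorem Pr.span (a : R) : Pr (Ideal.span {a}) := ⟨a, rfl⟩

end gen

variable {K : Type} [Field K] [NumberField K] [IsCyclotomicExtension {(29 : ℕ)} ℚ K]
  {ζ : 𝓞 K}
local notation "Kp" => maximalRealSubfield K

theorem Pr.cancel {I J : Ideal (𝓞 K)} (hI : Pr I) (hI0 : I ≠ ⊥) (hIJ : Pr (I * J)) : Pr J := by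
  obtain ⟨a, rfl⟩ := hI
  obtain ⟨b, hb⟩ := hIJ
  have ha : a ≠ 0 := by rintro rfl; simp at hI0
  have h1 : b ∈ Ideal.span {a} * J := hb ▸ Ideal.mem_span_singleton_self b
  obtain ⟨c, hc, h2⟩ := Ideal.mem_span_singleton_mul.mp h1
  refine ⟨c, ?_⟩
  rw [← h2, ← Ideal.span_singleton_mul_span_singleton] at hb
  exact mul_left_cancel₀ hI0 hb

theorem absNorm_map_e (e : 𝓞 K ≃+* 𝓞 K) (I : Ideal (𝓞 K)) :
    Ideal.absNorm (Ideal.map e I) = Ideal.absNorm I := by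
  rw [Ideal.absNorm_apply, Ideal.absNorm_apply, Submodule.cardQuot_apply, Submodule.cardQuot_apply]
  exact (Nat.card_congr (Ideal.quotientEquiv I (Ideal.map e I) e rfl).toEquiv).symm

theorem cj_map_map (hζ : IsPrimitiveRoot ζ 29) (I : Ideal (𝓞 K)) :
    Ideal.map (cj hζ) (Ideal.map (cj hζ) I) = I := by
  rw [map_e_comp (g := RingEquiv.refl _) (fun x => cj_cj hζ x)]
  ext x; rw [mem_map_e]; simp

theorem real_decomp (hζ : IsPrimitiveRoot ζ 29) (x : 𝓞 K) :
    ∃ a b : 𝓞 K, cj hζ a = a ∧ cj hζ b = b ∧ x = a + b * ζ := by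
  have h1 := IsCyclotomicExtension.Rat.adjoin_singleton_eq_top (prK hζ)
  rw [toInt_eq hζ] at h1
  have hx : x ∈ Algebra.adjoin ℤ {ζ} := h1 ▸ Algebra.mem_top
  have hz := cj_zeta hζ
  have hθ : cj hζ (ζ + cj hζ ζ) = ζ + cj hζ ζ := by rw [map_add, cj_cj, add_comm]
  induction hx using Algebra.adjoin_induction with
  | mem x hx =>
    rw [Set.mem_singleton_iff] at hx
    exact ⟨0, 1, map_zero _, map_one _, by rw [hx]; ring⟩
  | algebraMap r => exact ⟨r, 0, map_intCast _ _, map_zero _, by simp⟩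
  | add x y _ _ hx hy =>
    obtain ⟨a, b, ha, hb, rfl⟩ := hx
    obtain ⟨c, d, hc, hd, rfl⟩ := hy
    exact ⟨a + c, b + d, by rw [map_add, ha, hc], by rw [map_add, hb, hd], by ring⟩
  | mul x y _ _ hx hy =>
    obtain ⟨a, b, ha, hb, rfl⟩ := hx
    obtain ⟨c, d, hc, hd, rfl⟩ := hy
    refine ⟨a * c - b * d, a * d + b * c + b * d * (ζ + cj hζ ζ), ?_, ?_, ?_⟩
    · rw [map_sub, map_mul, map_mul, ha, hb, hc, hd]
    · rw [map_add, map_mul _ (b * d), hθ, map_add, map_mul, map_mul, map_mul, ha, hb, hc, hd]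
    · linear_combination (- b * d) * hz

theorem zeta_sub_one_mem (hζ : IsPrimitiveRoot ζ 29) {Q : Ideal (𝓞 K)} (hQ : Q.IsPrime)
    (h29 : (29 : 𝓞 K) ∈ Q) : ζ - 1 ∈ Q := by
  have hc : CharP (𝓞 K ⧸ Q) 29 := by
    have h0 : ((29 : ℕ) : 𝓞 K ⧸ Q) = 0 := by
      rw [← map_natCast (Ideal.Quotient.mk Q), Ideal.Quotient.eq_zero_iff_mem]; exact_mod_cast h29
    exact (CharP.charP_iff_prime_eq_zero (by norm_num)).mpr h0
  have : Fact (Nat.Prime 29) := ⟨by norm_num⟩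
  have h : (Ideal.Quotient.mk Q ζ - 1) ^ 29 = 0 := by
    rw [sub_pow_char, one_pow, ← map_pow, hζ.pow_eq_one, map_one, sub_self]
  have h1 := pow_eq_zero_iff (by norm_num : 29 ≠ 0) |>.mp h
  rw [← Ideal.Quotient.eq_zero_iff_mem, map_sub, map_one]; exact h1

theorem over29 (hζ : IsPrimitiveRoot ζ 29) {Q : Ideal (𝓞 K)} (hQ : Q.IsPrime)
    (h29 : (29 : 𝓞 K) ∈ Q) : Q = Ideal.span {ζ - 1} := by
  have h1 := zeta_sub_one_mem hζ hQ h29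
  have : Fact (Nat.Prime 29) := ⟨by norm_num⟩
  have hp := (prK hζ).zeta_sub_one_prime'
  rw [toInt_eq] at hp
  have hpi : (Ideal.span {ζ - 1}).IsPrime := (Ideal.span_singleton_prime hp.ne_zero).mpr hp
  have hm := hpi.isMaximal (by rw [Ne, Ideal.span_singleton_eq_bot]; exact hp.ne_zero)
  exact (hm.eq_of_le hQ.ne_top ((Ideal.span_singleton_le_iff_mem Q).mpr h1)).symm
  exact hζ

theorem exists_under (hζ : IsPrimitiveRoot ζ 29) (Q : Ideal (𝓞 K)) :
    ∃ t : 𝓞 Kp, Q.comap (algebraMap (𝓞 Kp) (𝓞 K)) = Ideal.span {t} := by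
  have := pid_real hζ
  obtain ⟨t, ht⟩ := IsPrincipalIdealRing.principal (Q.comap (algebraMap (𝓞 Kp) (𝓞 K)))
  exact ⟨t, ht⟩

theorem L3 (hζ : IsPrimitiveRoot ζ 29) {Q : Ideal (𝓞 K)} (hQ : Q.IsPrime)
    (hc : Ideal.map (cj hζ) Q = Q) : Pr Q := by
  by_cases h29 : (29 : 𝓞 K) ∈ Q
  · exact ⟨_, over29 hζ hQ h29⟩
  obtain ⟨t, ht⟩ := exists_under hζ Q
  refine ⟨algebraMap (𝓞 Kp) (𝓞 K) t, le_antisymm ?_ ?_⟩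
  · intro x hx
    obtain ⟨a, b, ha, hb, rfl⟩ := real_decomp hζ x
    have h1 : a + b * cj hζ ζ ∈ Q := by
      rw [← hc]
      have := (map_e_mem (cj hζ)).mpr hx
      rwa [map_add, map_mul, ha, hb] at this
    have h2 : b * (ζ ^ 2 - 1) ∈ Q := by
      have e : b * (ζ ^ 2 - 1) = ζ * ((a + b * ζ) - (a + b * cj hζ ζ)) := by
        linear_combination b * cj_zeta hζ
      rw [e]
      exact Q.mul_mem_left _ (sub_mem hx h1)
    have h3 : b ∈ Q := by
      rcases hQ.mem_or_mem h2 with h | h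
      · exact h
      · have := zeta_pow_mem hζ h29 h
        omega
    have h4 : a ∈ Q := by
      have : a = (a + b * ζ) - b * ζ := by ring
      rw [this]; exact sub_mem hx (Q.mul_mem_right _ h3)
    have key : ∀ a ∈ Q, cj hζ a = a → a ∈ Ideal.span {algebraMap (𝓞 Kp) (𝓞 K) t} := by
      intro a haQ ha
      obtain ⟨a', rfl⟩ := (real_iff hζ a).mp ha
      have : a' ∈ Q.comap (algebraMap (𝓞 Kp) (𝓞 K)) := haQ
      rw [ht, Ideal.mem_span_singleton] at this
      rw [Ideal.mem_span_singleton]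
      exact map_dvd _ this
    exact add_mem (key a h4 ha) (Ideal.mul_mem_right _ _ (key b h3 hb))
  · rw [Ideal.span_singleton_le_iff_mem]
    have : t ∈ Q.comap (algebraMap (𝓞 Kp) (𝓞 K)) := ht ▸ Ideal.mem_span_singleton_self t
    exact this

theorem L2prime (hζ : IsPrimitiveRoot ζ 29) {Q : Ideal (𝓞 K)} (hQ : Q.IsPrime) (hQ0 : Q ≠ ⊥) :
    ∃ p : 𝓞 K, cj hζ p = p ∧ Q * Ideal.map (cj hζ) Q = Ideal.span {p} := by
  by_cases hc : Ideal.map (cj hζ) Q = Q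
  · obtain ⟨a, rfl⟩ := L3 hζ hQ hc
    refine ⟨a * cj hζ a, by rw [map_mul, cj_cj, mul_comm], ?_⟩
    rw [map_e_span, Ideal.span_singleton_mul_span_singleton]
  obtain ⟨t, ht⟩ := exists_under hζ Q
  have htQ : algebraMap (𝓞 Kp) (𝓞 K) t ∈ Q := by
    have : t ∈ Q.comap (algebraMap (𝓞 Kp) (𝓞 K)) := ht ▸ Ideal.mem_span_singleton_self t
    exact this
  have hQm := hQ.isMaximal hQ0
  have hQ'm := (map_e_prime (cj hζ) hQ).isMaximal (map_e_ne_bot (cj hζ) hQ0)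
  refine ⟨_, cj_algebraMap hζ t, ?_⟩
  have htQ' : algebraMap (𝓞 Kp) (𝓞 K) t ∈ Ideal.map (cj hζ) Q := by
    rw [← cj_algebraMap hζ t, map_e_mem]; exact htQ
  have hcop : Q ⊔ Ideal.map (cj hζ) Q = ⊤ :=
    Ideal.isCoprime_iff_sup_eq.mp (Ideal.isCoprime_of_isMaximal (fun h => hc h.symm))
  have hle : Ideal.span {algebraMap (𝓞 Kp) (𝓞 K) t} ≤ Q * Ideal.map (cj hζ) Q := by
    rw [Ideal.mul_eq_inf_of_coprime hcop, Ideal.span_singleton_le_iff_mem]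
    exact ⟨htQ, htQ'⟩
  have hq0 : Q.comap (algebraMap (𝓞 Kp) (𝓞 K)) ≠ ⊥ := Ideal.IsIntegral.comap_ne_bot _ hQ0
  have ht0 : t ≠ 0 := by
    rintro rfl
    apply hq0; rw [ht]; simp
  symm
  apply ideal_eq_of_le hle
  · rw [Ne, Ideal.span_singleton_eq_bot, map_eq_zero_iff _ (FaithfulSMul.algebraMap_injective _ _)]
    exact ht0
  · have h1 := absNorm_ext (K := K) (Ideal.span {t})
    rw [Ideal.map_span, Set.image_singleton] at h1
    rw [h1, map_mul, absNorm_map_e, ← sq]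
    apply pow_dvd_pow_of_dvd
    rw [← ht, Ideal.absNorm_apply, Ideal.absNorm_apply, Submodule.cardQuot_apply, Submodule.cardQuot_apply]
    exact AddSubgroup.card_dvd_of_injective (Ideal.quotientMap Q (algebraMap (𝓞 Kp) (𝓞 K)) le_rfl).toAddMonoidHom
      (Ideal.quotientMap_injective)

theorem L2 (hζ : IsPrimitiveRoot ζ 29) (I : Ideal (𝓞 K)) :
    ∃ p : 𝓞 K, cj hζ p = p ∧ I * Ideal.map (cj hζ) I = Ideal.span {p} := by
  induction I using UniqueFactorizationMonoid.induction_on_prime with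
  | h₁ => exact ⟨0, map_zero _, by simp⟩
  | h₂ x hx =>
    rw [Ideal.isUnit_iff] at hx
    refine ⟨1, map_one _, ?_⟩
    rw [hx, Ideal.map_top, Ideal.top_mul, Ideal.span_singleton_one]
  | h₃ a p ha hp ih =>
    obtain ⟨x, hx, h⟩ := ih
    obtain ⟨y, hy, h'⟩ := L2prime hζ (Ideal.isPrime_of_prime hp) hp.ne_zero
    refine ⟨y * x, by rw [map_mul, hx, hy], ?_⟩
    rw [Ideal.map_mul, mul_mul_mul_comm, h, h', Ideal.span_singleton_mul_span_singleton]

theorem L4 (hζ : IsPrimitiveRoot ζ 29) (I : Ideal (𝓞 K)) (hI : I ≠ ⊥)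
    (hc : Ideal.map (cj hζ) I = I) : Pr I := by
  have hN : ∀ J : Ideal (𝓞 K), J ≠ ⊥ → 0 < Ideal.absNorm J := fun J hJ =>
    Nat.pos_of_ne_zero (by rwa [Ne, Ideal.absNorm_eq_zero_iff])
  induction hn : Ideal.absNorm I using Nat.strong_induction_on generalizing I with
  | _ n ih =>
    by_cases ht : I = ⊤
    · exact ⟨1, by rw [ht, Ideal.span_singleton_one]⟩
    obtain ⟨Q, hQm, hIQ⟩ := Ideal.exists_le_maximal I ht
    have hQ0 : Q ≠ ⊥ := fun h => hI (by rw [h] at hIQ; exact le_bot_iff.mp hIQ)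
    have step : ∀ J : Ideal (𝓞 K), J ≠ ⊥ → J ≤ Q → Pr J → Ideal.map (cj hζ) J = J → I ≤ J → Pr I := by
      intro J hJ0 hJQ hJ hJc hIJ
      obtain ⟨L, hL⟩ := Ideal.dvd_iff_le.mpr hIJ
      have hL0 : L ≠ ⊥ := by rintro rfl; rw [Ideal.mul_bot] at hL; exact hI hL
      have hLc : Ideal.map (cj hζ) L = L := by
        rw [hL, Ideal.map_mul, hJc] at hc
        exact mul_left_cancel₀ hJ0 hc
      rw [hL]
      refine hJ.mul (ih (Ideal.absNorm L) ?_ L hL0 hLc rfl)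
      rw [← hn, hL, map_mul]
      have h1 : 1 < Ideal.absNorm J := by
        have h2 : Ideal.absNorm J ≠ 1 := by
          rw [Ne, Ideal.absNorm_eq_one_iff]; rintro rfl
          exact hQm.ne_top (top_le_iff.mp hJQ)
        have := hN J hJ0
        omega
      exact lt_mul_of_one_lt_left (hN L hL0) h1
    by_cases hQc : Ideal.map (cj hζ) Q = Q
    · exact step Q hQ0 le_rfl (L3 hζ hQm.isPrime hQc) hQc hIQ
    · have hQ'm := (map_e_prime (cj hζ) hQm.isPrime).isMaximal (map_e_ne_bot (cj hζ) hQ0)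
      have hcop : Q ⊔ Ideal.map (cj hζ) Q = ⊤ :=
        Ideal.isCoprime_iff_sup_eq.mp (Ideal.isCoprime_of_isMaximal (fun h => hQc h.symm))
      refine step (Q * Ideal.map (cj hζ) Q) (mul_ne_zero hQ0 (map_e_ne_bot _ hQ0)) Ideal.mul_le_left ?_ ?_ ?_
      · obtain ⟨p, -, hp⟩ := L2 hζ Q
        exact ⟨p, hp⟩
      · rw [Ideal.map_mul, cj_map_map, mul_comm]
      · rw [Ideal.mul_eq_inf_of_coprime hcop]
        refine le_inf hIQ ?_
        rw [← hc]; exact Ideal.map_mono hIQ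

end P6

section P7
set_option linter.unusedSectionVars false
set_option linter.style.haveILetI false
set_option linter.unusedVariables false

theorem add_prod {G : Type*} [CommMonoid G] (P : G → Prop) (h : G → ZMod 2) (hP1 : P 1)
    (hPm : ∀ x y, P x → P y → P (x * y)) (h1 : h 1 = 0)
    (hm : ∀ x y, P x → P y → h (x * y) = h x + h y) {n : ℕ} (g : Fin n → G) (hg : ∀ i, P (g i))
    (e : Fin n → ZMod 2) : P (∏ i, g i ^ (e i).val) ∧ h (∏ i, g i ^ (e i).val) = ∑ i, e i * h (g i) := by
  have key : ∀ s : Finset (Fin n), P (∏ i ∈ s, g i ^ (e i).val) ∧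
      h (∏ i ∈ s, g i ^ (e i).val) = ∑ i ∈ s, e i * h (g i) := by
    intro s
    induction s using Finset.induction_on with
    | empty => simp [hP1, h1]
    | insert a s ha ih =>
      rw [Finset.prod_insert ha, Finset.sum_insert ha]
      have hz : ∀ z : ZMod 2, z = 0 ∨ z = 1 := by decide
      have : P (g a ^ (e a).val) ∧ h (g a ^ (e a).val) = e a * h (g a) := by
        rcases hz (e a) with h0 | h0
        · rw [h0]; simp [hP1, h1]
        · rw [h0]
          have : (1 : ZMod 2).val = 1 := rfl
          rw [this]; simp [hg]
      exact ⟨hPm _ _ this.1 ih.1, by rw [hm _ _ this.1 ih.1, this.2, ih.2]⟩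
  exact key _

def bt (l : List ℕ) (i j : ℕ) : ZMod 2 := if (l.getD i 0).testBit j then 1 else 0

def gval {R : Type*} [CommRing R] (r : R) (i : ℕ) : R :=
  if i = 0 then -1 else r ^ (29 - i) * ∑ k ∈ Finset.range (i + 1), (r ^ 2) ^ k

def lgm (i j : ℕ) : ZMod 2 := if (gval ((4 : ZMod 59) ^ j) i) ^ 29 = 1 then 0 else 1

variable {K : Type} [Field K] [NumberField K] [IsCyclotomicExtension {(29 : ℕ)} ℚ K] {ζ : 𝓞 K}

theorem gval_unit (hζ : IsPrimitiveRoot ζ 29) (i : Fin 14) : IsUnit (gval ζ i) := by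
  unfold gval
  split_ifs with h
  · exact isUnit_one.neg
  · apply IsUnit.mul
    · exact (hζ.isUnit (by norm_num)).pow _
    · have h2 : IsPrimitiveRoot (ζ ^ 2) 29 := hζ.pow_of_coprime 2 (by norm_num)
      apply h2.geom_sum_isUnit (by norm_num)
      rw [Nat.coprime_comm, Nat.Prime.coprime_iff_not_dvd (by norm_num)]
      have := i.2
      omega

noncomputable def gu (hζ : IsPrimitiveRoot ζ 29) (i : Fin 14) : (𝓞 K)ˣ := (gval_unit hζ i).unit

theorem gu_val (hζ : IsPrimitiveRoot ζ 29) (i : Fin 14) : (gu hζ i : 𝓞 K) = gval ζ i := rfl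

theorem map_gval {R S : Type*} [CommRing R] [CommRing S] (f : R →+* S) (r : R) (i : ℕ) :
    f (gval r i) = gval (f r) i := by
  unfold gval
  split_ifs <;> simp

theorem gval_mul {R : Type*} [CommRing R] {r : R} (h : r ^ 29 = 1) {i : ℕ} (hi : i ≠ 0) (hi2 : i < 29) :
    gval r i * (r - r ^ 28) = r ^ (i + 1) - r ^ (28 - i) := by
  unfold gval
  rw [if_neg hi]
  have h1 := geom_sum_mul (r ^ 2) (i + 1)
  have h2 : r - r ^ 28 = r ^ 28 * (r ^ 2 - 1) := by linear_combination (-r) * h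
  rw [h2]
  have h3 : r ^ (29 - i) * (∑ k ∈ Finset.range (i + 1), (r ^ 2) ^ k) * (r ^ 28 * (r ^ 2 - 1)) =
    r ^ (29 - i) * r ^ 28 * ((r ^ 2) ^ (i + 1) - 1) := by rw [← h1]; ring
  rw [h3, ← pow_add, mul_sub, mul_one, ← pow_mul, ← pow_add]
  have e1 : 29 - i + 28 + 2 * (i + 1) = 29 * 2 + (i + 1) := by omega
  have e2 : 29 - i + 28 = 29 * 1 + (28 - i) := by omega
  rw [e1, e2, pow_add r (29 * 2), pow_add r (29 * 1), pow_mul, pow_mul, h]; ring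

theorem z59 (x : ZMod 59) (hx : x ≠ 0) : x ^ 29 = 1 ∨ x ^ 29 = -1 := by
  revert x; decide +kernel

theorem exists_h59 (hζ : IsPrimitiveRoot ζ 29) (j : ℕ) :
    ∃ f : 𝓞 K →+* ZMod 59, ¬ 29 ∣ j → f ζ = 4 ^ j := by
  have d1 : (4 : ZMod 59) ^ 29 = 1 := by decide +kernel
  have d2 : (4 : ZMod 59) ≠ 1 := by decide +kernel
  haveI : Fact (Nat.Prime 59) := ⟨by norm_num⟩
  have h4 : IsPrimitiveRoot (4 : ZMod 59) 29 := by
    rw [IsPrimitiveRoot.iff_orderOf]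
    haveI : Fact (Nat.Prime 29) := ⟨by norm_num⟩
    exact orderOf_eq_prime d1 d2
  by_cases hj : 29 ∣ j
  · obtain ⟨f, hf⟩ := exists_hom hζ (4 : ZMod 59) (geom29 h4.pow_eq_one (h4.ne_one (by norm_num)))
    exact ⟨f, fun h => absurd hj h⟩
  · obtain ⟨f, hf⟩ := exists_hom hζ ((4 : ZMod 59) ^ j) (geom29
      (by rw [← pow_mul, mul_comm, pow_mul, h4.pow_eq_one, one_pow])
      (fun h => hj (h4.dvd_of_pow_eq_one j h)))
    exact ⟨f, fun _ => hf⟩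

noncomputable def h59 (hζ : IsPrimitiveRoot ζ 29) (j : ℕ) : 𝓞 K →+* ZMod 59 := (exists_h59 hζ j).choose
theorem h59_zeta (hζ : IsPrimitiveRoot ζ 29) {j : ℕ} (hj : ¬ 29 ∣ j) : h59 hζ j ζ = 4 ^ j :=
  (exists_h59 hζ j).choose_spec hj

noncomputable def lg (hζ : IsPrimitiveRoot ζ 29) (j : ℕ) (u : (𝓞 K)ˣ) : ZMod 2 :=
  if (h59 hζ j u) ^ 29 = 1 then 0 else 1

theorem h59_ne (hζ : IsPrimitiveRoot ζ 29) (j : ℕ) (u : (𝓞 K)ˣ) : h59 hζ j u ≠ 0 := by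
  haveI : Fact (Nat.Prime 59) := ⟨by norm_num⟩
  exact (u.isUnit.map (h59 hζ j)).ne_zero

theorem lg_mul (hζ : IsPrimitiveRoot ζ 29) (j : ℕ) (u v : (𝓞 K)ˣ) :
    lg hζ j (u * v) = lg hζ j u + lg hζ j v := by
  unfold lg
  have hne : (-1 : ZMod 59) ≠ 1 := by decide
  rw [Units.val_mul, map_mul, mul_pow]
  rcases z59 _ (h59_ne hζ j u) with h | h <;> rcases z59 _ (h59_ne hζ j v) with h' | h' <;>
    rw [h, h'] <;> simp [hne]
  decide

theorem lg_one (hζ : IsPrimitiveRoot ζ 29) (j : ℕ) : lg hζ j (1 : (𝓞 K)ˣ) = 0 := by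
  simp [lg]

theorem lg_gu (hζ : IsPrimitiveRoot ζ 29) {j : ℕ} (hj : ¬ 29 ∣ j) (i : Fin 14) :
    lg hζ j (gu hζ i) = lgm i j := by
  unfold lg lgm
  rw [gu_val, map_gval, h59_zeta hζ hj]

noncomputable def gp (hζ : IsPrimitiveRoot ζ 29) (e : Fin 14 → ZMod 2) : (𝓞 K)ˣ :=
  ∏ i, gu hζ i ^ (e i).val

theorem lg_gp (hζ : IsPrimitiveRoot ζ 29) {j : ℕ} (hj : ¬ 29 ∣ j) (e : Fin 14 → ZMod 2) :
    lg hζ j (gp hζ e) = ∑ i, e i * lgm i j := by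
  have := (add_prod (fun _ : (𝓞 K)ˣ => True) (lg hζ j) trivial (fun _ _ _ _ => trivial) (lg_one hζ j)
    (fun x y _ _ => lg_mul hζ j x y) (gu hζ) (fun _ => trivial) e).2
  unfold gp
  rw [this]
  exact Finset.sum_congr rfl fun i _ => by rw [lg_gu hζ hj]

def Nl : List ℕ := [616, 1047, 7170, 6400, 4179, 416, 5137, 8865, 8488, 3200, 583, 8716, 93, 10625]

theorem NM : ∀ i j : Fin 14, ∑ k : Fin 14, bt Nl i k * lgm k (j + 1) = if i = j then 1 else 0 := by
  decide +kernel

noncomputable def lgH (hζ : IsPrimitiveRoot ζ 29) : (𝓞 K)ˣ →* Multiplicative (Fin 14 → ZMod 2) where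
  toFun u := Multiplicative.ofAdd (fun j => lg hζ (j + 1) u)
  map_one' := by
    rw [← ofAdd_zero]; congr 1; funext j; exact lg_one hζ _
  map_mul' u v := by
    rw [← ofAdd_add]; congr 1; funext j; exact lg_mul hζ _ u v

theorem lgH_surj (hζ : IsPrimitiveRoot ζ 29) (v : Fin 14 → ZMod 2) :
    ∃ e, ∀ j : Fin 14, lg hζ (j + 1) (gp hζ e) = v j := by
  refine ⟨fun i => ∑ k : Fin 14, v k * bt Nl k i, fun j => ?_⟩
  rw [lg_gp hζ (by have := j.2; omega)]
  simp_rw [Finset.sum_mul, mul_assoc]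
  rw [Finset.sum_comm]
  simp_rw [← Finset.mul_sum, NM]
  simp

theorem rank29 : Units.rank K = 13 := by
  unfold Units.rank
  rw [InfinitePlace.card_eq_nrRealPlaces_add_nrComplexPlaces,
    IsCyclotomicExtension.Rat.nrRealPlaces_eq_zero (n := 29) K (by norm_num),
    IsCyclotomicExtension.Rat.nrComplexPlaces_eq_totient_div_two (n := 29) K,
    Nat.totient_prime (by norm_num)]

theorem sq_index : (powMonoidHom 2 : (𝓞 K)ˣ →* (𝓞 K)ˣ).range.index ≠ 0 ∧
    (powMonoidHom 2 : (𝓞 K)ˣ →* (𝓞 K)ˣ).range.index ≤ 2 ^ 14 := by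
  obtain ⟨g, hg⟩ := IsCyclic.exists_generator (α := Units.torsion K)
  set H := (powMonoidHom 2 : (𝓞 K)ˣ →* (𝓞 K)ˣ).range
  let F : Fin 2 × (Fin (Units.rank K) → Fin 2) → (𝓞 K)ˣ ⧸ H := fun p =>
    QuotientGroup.mk ((g : (𝓞 K)ˣ) ^ (p.1 : ℕ) * ∏ i, (Units.fundSystem K i) ^ (p.2 i : ℕ))
  have sqr : ∀ (x : (𝓞 K)ˣ) (n : ℤ), ∃ (m : Fin 2) (y : (𝓞 K)ˣ), x ^ n = x ^ (m : ℕ) * y ^ 2 := by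
    intro x n
    refine ⟨⟨(n % 2).toNat, by omega⟩, x ^ (n / 2), ?_⟩
    have h2 : x ^ (n % 2).toNat = x ^ (n % 2) := by
      rw [← zpow_natCast, Int.toNat_of_nonneg (by omega)]
    simp only [h2]
    rw [← zpow_natCast, ← zpow_mul, ← zpow_add]
    congr 1; push_cast; omega
  have hF : Function.Surjective F := by
    intro q
    obtain ⟨x, rfl⟩ := QuotientGroup.mk_surjective q
    obtain ⟨⟨z, e⟩, hx, -⟩ := Units.exist_unique_eq_mul_prod K x
    simp only at hx
    obtain ⟨n, hn⟩ := Subgroup.mem_zpowers_iff.mp (hg z)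
    obtain ⟨m, y, hy⟩ := sqr (g : (𝓞 K)ˣ) n
    choose m' y' hy' using fun i => sqr (Units.fundSystem K i) (e i)
    refine ⟨(m, m'), ?_⟩
    simp only [F]
    rw [QuotientGroup.eq]
    refine ⟨y * ∏ i, y' i, ?_⟩
    rw [powMonoidHom_apply, hx, ← hn]
    rw [Subgroup.coe_zpow, hy, Finset.prod_congr rfl (fun i _ => hy' i), Finset.prod_mul_distrib,
      mul_pow, ← Finset.prod_pow]
    exact eq_inv_mul_iff_mul_eq.mpr (by ac_rfl)
  have hfin : Finite ((𝓞 K)ˣ ⧸ H) := Finite.of_surjective F hF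
  refine ⟨Nat.card_pos.ne', ?_⟩
  rw [Subgroup.index]
  refine (Nat.card_le_card_of_surjective F hF).trans ?_
  rw [rank29]
  simp

theorem T1 (hζ : IsPrimitiveRoot ζ 29) (u : (𝓞 K)ˣ) (h : ∀ j : Fin 14, lg hζ (j + 1) u = 0) :
    ∃ v, u = v ^ 2 := by
  have hle : (powMonoidHom 2 : (𝓞 K)ˣ →* (𝓞 K)ˣ).range ≤ (lgH hζ).ker := by
    rintro _ ⟨v, rfl⟩
    rw [MonoidHom.mem_ker, powMonoidHom_apply, map_pow]
    apply Multiplicative.toAdd.injective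
    rw [toAdd_pow]; funext j
    have hz : ∀ z : ZMod 2, 2 • z = 0 := by decide
    exact hz _
  have hidx : (lgH hζ).ker.index = 2 ^ 14 := by
    rw [Subgroup.index_ker, MonoidHom.range_eq_top.mpr]
    · simp [Nat.card_eq_fintype_card]
    · intro v
      obtain ⟨e, he⟩ := lgH_surj hζ (Multiplicative.toAdd v)
      exact ⟨gp hζ e, by apply Multiplicative.toAdd.injective; funext j; exact he j⟩
  obtain ⟨h0, h1⟩ := sq_index (K := K)
  have h2 := Subgroup.relIndex_mul_index hle
  rw [hidx] at h2
  have h3 : (powMonoidHom 2 : (𝓞 K)ˣ →* (𝓞 K)ˣ).range.relIndex (lgH hζ).ker = 1 := by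
    have : (powMonoidHom 2 : (𝓞 K)ˣ →* (𝓞 K)ˣ).range.relIndex (lgH hζ).ker ≠ 0 := by
      intro h; rw [h] at h2; simp at h2; exact h0 (by simpa using h2.symm)
    nlinarith [Nat.pos_of_ne_zero this]
  rw [Subgroup.relIndex_eq_one] at h3
  have : u ∈ (lgH hζ).ker := by
    rw [MonoidHom.mem_ker]
    apply Multiplicative.toAdd.injective
    funext j; exact h j
  obtain ⟨v, hv⟩ := h3 this
  exact ⟨v, hv.symm⟩

theorem T2 (hζ : IsPrimitiveRoot ζ 29) (u : (𝓞 K)ˣ) : ∃ e v, u = gp hζ e * v ^ 2 := by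
  obtain ⟨e, he⟩ := lgH_surj hζ (fun j => lg hζ (j + 1) u)
  obtain ⟨v, hv⟩ := T1 hζ (u * gp hζ e) (fun j => by
    rw [lg_mul, he]; have hz : ∀ z : ZMod 2, z + z = 0 := by decide
    exact hz _)
  refine ⟨e, v * (gp hζ e)⁻¹, ?_⟩
  rw [mul_pow, ← hv, inv_pow, ← mul_assoc, eq_mul_inv_iff_mul_eq, sq]; ac_rfl

end P7

section P8
set_option linter.unusedSectionVars false
set_option linter.style.haveILetI false
set_option linter.unusedVariables false

variable {K : Type} [Field K] [NumberField K] [IsCyclotomicExtension {(29 : ℕ)} ℚ K] {ζ : 𝓞 K}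

theorem T3 (hζ : IsPrimitiveRoot ζ 29) (v : (𝓞 K)ˣ) (h : cj hζ (v : 𝓞 K) ^ 2 = (v : 𝓞 K) ^ 2) :
    cj hζ (v : 𝓞 K) = v := by
  rcases sq_eq_sq_iff_eq_or_eq_neg.mp h with h | h
  · exact h
  exfalso
  have d1 : ∀ x : ZMod 29, x = -x → x = 0 := by decide +kernel
  have d2 : ∑ i ∈ Finset.range 29, (1 : ZMod 29) ^ i = 0 := by decide +kernel
  haveI : Fact (Nat.Prime 29) := ⟨by norm_num⟩
  obtain ⟨g, hg⟩ := exists_hom hζ (1 : ZMod 29) d2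
  have h1 : g.comp (cj hζ : 𝓞 K →+* 𝓞 K) = g := by
    apply hom_ext29 hζ
    have := congrArg g (cj_zeta hζ)
    rw [map_mul, hg, mul_one, map_one] at this
    simpa [hg] using this
  have h2 : g (cj hζ (v : 𝓞 K)) = g v := RingHom.congr_fun h1 _
  rw [h, map_neg] at h2
  exact (v.isUnit.map g).ne_zero (d1 _ h2.symm)

theorem emb_cj (hζ : IsPrimitiveRoot ζ 29) (f : 𝓞 K →+* ℂ) (x : 𝓞 K) :
    f (cj hζ x) = (starRingEnd ℂ) (f x) := by
  have : f.comp (cj hζ : 𝓞 K →+* 𝓞 K) = (starRingEnd ℂ).comp f := by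
    apply hom_ext29 hζ
    have h1 := congrArg f (cj_zeta hζ)
    rw [map_mul, map_one] at h1
    have h2 : ‖f ζ‖ = 1 := by
      apply Complex.norm_eq_one_of_pow_eq_one (n := 29) _ (by norm_num)
      rw [← map_pow, hζ.pow_eq_one, map_one]
    have h3 : (starRingEnd ℂ) (f ζ) * f ζ = 1 := by
      rw [mul_comm, Complex.mul_conj, Complex.normSq_eq_norm_sq, h2]; norm_num
    have h4 : f ζ ≠ 0 := by intro h; rw [h] at h2; simp at h2
    exact mul_right_cancel₀ h4 (h1.trans h3.symm)
  exact RingHom.congr_fun this x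

theorem emb_real (hζ : IsPrimitiveRoot ζ 29) (f : 𝓞 K →+* ℂ) {x : 𝓞 K} (hx : cj hζ x = x) :
    f x = ((f x).re : ℂ) := by
  have := emb_cj hζ f x
  rw [hx] at this
  exact (Complex.conj_eq_iff_re.mp this.symm).symm

theorem emb_inj (f : 𝓞 K →+* ℂ) : Function.Injective f := by
  rw [injective_iff_map_eq_zero]
  intro x hx
  by_contra h0
  have h1 : Algebra.norm ℤ x ≠ 0 := by rwa [Ne, Algebra.norm_eq_zero_iff]
  have h2 : x ∣ ((Algebra.norm ℤ x : ℤ) : 𝓞 K) := by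
    have := Ideal.absNorm_mem (Ideal.span {x})
    rw [Ideal.mem_span_singleton, Ideal.absNorm_span_singleton] at this
    rcases Int.natAbs_eq (Algebra.norm ℤ x) with h | h
    · rw [h]; simpa using this
    · rw [h]; simpa using this
  obtain ⟨y, hy⟩ := h2
  have := congrArg f hy
  rw [map_mul, hx, zero_mul, map_intCast] at this
  exact h1 (by exact_mod_cast this)

theorem emb_re_ne (hζ : IsPrimitiveRoot ζ 29) (f : 𝓞 K →+* ℂ) {x : 𝓞 K} (hx : cj hζ x = x)
    (h0 : x ≠ 0) : (f x).re ≠ 0 := by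
  intro h
  have := emb_real hζ f hx
  rw [h, Complex.ofReal_zero] at this
  exact h0 (emb_inj f (this.trans (map_zero f).symm))

noncomputable def emj (hζ : IsPrimitiveRoot ζ 29) (j : Fin 14) : 𝓞 K →+* ℂ :=
  (exists_emb hζ (j := j + 1) (by have := j.2; omega)).choose
theorem emj_zeta (hζ : IsPrimitiveRoot ζ 29) (j : Fin 14) :
    emj hζ j ζ = Complex.exp (2 * Real.pi * Complex.I / 29) ^ ((j : ℕ) + 1) :=
  (exists_emb hζ (j := j + 1) (by have := j.2; omega)).choose_spec

noncomputable def sb (hζ : IsPrimitiveRoot ζ 29) (j : Fin 14) (x : 𝓞 K) : ZMod 2 :=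
  if 0 < (emj hζ j x).re then 0 else 1

theorem sb_mul (hζ : IsPrimitiveRoot ζ 29) (j : Fin 14) {x y : 𝓞 K} (hx : cj hζ x = x)
    (hy : cj hζ y = y) (hx0 : x ≠ 0) (hy0 : y ≠ 0) :
    sb hζ j (x * y) = sb hζ j x + sb hζ j y := by
  have h1 := emb_re_ne hζ (emj hζ j) hx hx0
  have h2 := emb_re_ne hζ (emj hζ j) hy hy0
  have h3 : (emj hζ j (x * y)).re = (emj hζ j x).re * (emj hζ j y).re := by
    rw [map_mul, emb_real hζ _ hx, emb_real hζ _ hy, ← Complex.ofReal_mul]; simp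
  unfold sb
  rw [h3]
  have d : (1 : ZMod 2) + 1 = 0 := by decide
  rcases lt_or_gt_of_ne h1 with h1 | h1 <;> rcases lt_or_gt_of_ne h2 with h2 | h2
  · rw [if_pos (mul_pos_of_neg_of_neg h1 h2), if_neg h1.le.not_gt, if_neg h2.le.not_gt, d]
  · rw [if_neg (mul_neg_of_neg_of_pos h1 h2).le.not_gt, if_neg h1.le.not_gt, if_pos h2, add_zero]
  · rw [if_neg (mul_neg_of_pos_of_neg h1 h2).le.not_gt, if_pos h1, if_neg h2.le.not_gt, zero_add]
  · rw [if_pos (mul_pos h1 h2), if_pos h1, if_pos h2, zero_add]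

theorem sb_one (hζ : IsPrimitiveRoot ζ 29) (j : Fin 14) : sb hζ j (1 : 𝓞 K) = 0 := by
  simp [sb]

theorem sb_norm (hζ : IsPrimitiveRoot ζ 29) (j : Fin 14) {x : 𝓞 K} (hx : x ≠ 0) :
    sb hζ j (x * cj hζ x) = 0 := by
  unfold sb
  rw [if_pos]
  rw [map_mul, emb_cj, Complex.mul_conj, Complex.ofReal_re, Complex.normSq_pos]
  exact fun h => hx (emb_inj _ (h.trans (map_zero _).symm))

theorem gu_real (hζ : IsPrimitiveRoot ζ 29) (i : Fin 14) : cj hζ (gu hζ i : 𝓞 K) = gu hζ i := by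
  rw [gu_val]
  by_cases hi : (i : ℕ) = 0
  · unfold gval; rw [if_pos hi]; simp
  have hi2 : (i : ℕ) < 29 := by have := i.2; omega
  have h1 := gval_mul hζ.pow_eq_one hi hi2
  have h2 := congrArg (cj hζ) h1
  have hz := cj_zeta_pow hζ (k := 1) (by norm_num)
  rw [pow_one] at hz
  rw [map_mul, map_sub, map_sub, hz, cj_zeta_pow hζ (by norm_num), cj_zeta_pow hζ (by omega),
    cj_zeta_pow hζ (by omega)] at h2
  have e1 : 29 - ((i : ℕ) + 1) = 28 - i := by omega
  have e2 : 29 - (28 - (i : ℕ)) = i + 1 := by omega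
  rw [e1, e2] at h2
  have h0 : ζ - ζ ^ 28 ≠ 0 := by
    intro h
    have : ζ ^ 28 = ζ ^ 1 := by rw [pow_one]; exact (sub_eq_zero.mp h).symm
    have := hζ.pow_inj (by norm_num) (by norm_num) this
    omega
  apply mul_right_cancel₀ h0
  linear_combination -h2 - h1

def sgb (n : ℕ) : ZMod 2 := if n % 29 ≤ 14 then 0 else 1
def sgm (i j : ℕ) : ZMod 2 := if i = 0 then 1 else sgb ((i + 1) * j) + sgb j

theorem sin_sign {n : ℕ} (hn : ¬ 29 ∣ n) :
    (sgb n = 0 ∧ 0 < Real.sin (2 * Real.pi * n / 29)) ∨ (sgb n = 1 ∧ Real.sin (2 * Real.pi * n / 29) < 0) := by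
  have h1 : 2 * Real.pi * n / 29 = 2 * Real.pi * (n % 29 : ℕ) / 29 + (n / 29 : ℕ) * (2 * Real.pi) := by
    have : (n : ℝ) = 29 * (n / 29 : ℕ) + (n % 29 : ℕ) := by exact_mod_cast (Nat.div_add_mod n 29).symm
    rw [this]; 
    have e : (29 * (n / 29) + n % 29) % 29 = n % 29 := by omega
    push_cast
    ring
  have hp := Real.pi_pos
  rw [h1, Real.sin_add_nat_mul_two_pi]
  have hm : n % 29 ≠ 0 := fun h => hn (Nat.dvd_of_mod_eq_zero h)
  have hm2 : n % 29 < 29 := Nat.mod_lt _ (by norm_num)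
  unfold sgb
  set m := n % 29
  by_cases h : m ≤ 14
  · left
    refine ⟨if_pos h, Real.sin_pos_of_pos_of_lt_pi ?_ ?_⟩
    · have : (0 : ℝ) < m := by exact_mod_cast Nat.pos_of_ne_zero hm
      positivity
    · have : (m : ℝ) ≤ 14 := by exact_mod_cast h
      rw [div_lt_iff₀ (by norm_num)]; nlinarith
  · right
    refine ⟨if_neg h, ?_⟩
    rw [← Real.sin_sub_two_pi]
    apply Real.sin_neg_of_neg_of_neg_pi_lt
    · have : (m : ℝ) < 29 := by exact_mod_cast hm2
      rw [sub_neg, div_lt_iff₀ (by norm_num)]; nlinarith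
    · have : (15 : ℝ) ≤ m := by exact_mod_cast (by omega : 15 ≤ m)
      rw [lt_sub_iff_add_lt, lt_div_iff₀ (by norm_num)]; nlinarith

theorem emj_sin (hζ : IsPrimitiveRoot ζ 29) (j : Fin 14) {k : ℕ} (hk : k ≤ 29) :
    emj hζ j (ζ ^ k - ζ ^ (29 - k)) = (2 * Real.sin (2 * Real.pi * (k * (j + 1) : ℕ) / 29) : ℝ) * Complex.I := by
  have h0 : emj hζ j (ζ ^ k) = Complex.exp ((2 * Real.pi * (k * (j + 1) : ℕ) / 29 : ℝ) * Complex.I) := by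
    rw [map_pow, emj_zeta, ← pow_mul, ← Complex.exp_nat_mul]
    congr 1; push_cast; ring
  rw [← cj_zeta_pow hζ hk, map_sub, emb_cj, h0, Complex.sub_conj, Complex.exp_ofReal_mul_I_im]

theorem sb_gu (hζ : IsPrimitiveRoot ζ 29) (j i : Fin 14) :
    sb hζ j (gu hζ i : 𝓞 K) = sgm i (j + 1) := by
  unfold sgm
  by_cases hi : (i : ℕ) = 0
  · rw [if_pos hi, gu_val]; unfold gval sb; rw [if_pos hi]; norm_num
  rw [if_neg hi]
  have hi2 := i.2
  have hj2 := j.2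
  have h1 := congrArg (emj hζ j) (gval_mul hζ.pow_eq_one hi (by omega))
  have e1 : 28 - (i : ℕ) = 29 - (i + 1) := by omega
  have e2 := emj_sin hζ j (k := 1) (by norm_num)
  rw [pow_one] at e2
  rw [map_mul, e1, emj_sin hζ j (by omega), ← gu_val hζ i, e2, emb_real hζ _ (gu_real hζ i)] at h1
  have h2 := congrArg Complex.im h1
  have h3 : (emj hζ j (gu hζ i : 𝓞 K)).re * Real.sin (2 * Real.pi * (1 * (j + 1) : ℕ) / 29) =
      Real.sin (2 * Real.pi * ((i + 1) * (j + 1) : ℕ) / 29) := by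
    rw [← mul_assoc, ← Complex.ofReal_mul] at h2
    simp only [Complex.re_ofReal_mul, Complex.im_ofReal_mul, Complex.I_im, mul_one] at h2
    linarith
  have hp : Nat.Prime 29 := by norm_num
  have n1 : ¬ 29 ∣ 1 * ((j : ℕ) + 1) := by omega
  have n2 : ¬ 29 ∣ ((i : ℕ) + 1) * ((j : ℕ) + 1) := by
    rw [hp.dvd_mul]; omega
  have d : (1 : ZMod 2) + 1 = 0 := by decide
  rw [← one_mul ((j : ℕ) + 1)]
  unfold sb
  rw [one_mul ((j : ℕ) + 1)] at *
  rcases sin_sign n1 with ⟨a1, b1⟩ | ⟨a1, b1⟩ <;> rcases sin_sign n2 with ⟨a2, b2⟩ | ⟨a2, b2⟩ <;>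
    rw [a1, a2]
  · rw [if_pos, add_zero]; by_contra h; nlinarith
  · rw [if_neg, add_zero]; intro h; nlinarith
  · rw [if_neg, zero_add]; intro h; nlinarith
  · rw [if_pos, d]; by_contra h; nlinarith

theorem sb_gp (hζ : IsPrimitiveRoot ζ 29) (j : Fin 14) (e : Fin 14 → ZMod 2) :
    cj hζ (gp hζ e : 𝓞 K) = gp hζ e ∧ sb hζ j (gp hζ e : 𝓞 K) = ∑ i : Fin 14, e i * sgm i (j + 1) := by
  have := (add_prod (fun u : (𝓞 K)ˣ => cj hζ (u : 𝓞 K) = u) (fun u => sb hζ j (u : 𝓞 K)) (by simp)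
    (fun x y hx hy => by rw [Units.val_mul, map_mul, hx, hy]) (sb_one hζ j)
    (fun x y hx hy => by rw [Units.val_mul, sb_mul hζ j hx hy x.ne_zero y.ne_zero]) (gu hζ)
    (gu_real hζ) e)
  refine ⟨this.1, this.2.trans ?_⟩
  exact Finset.sum_congr rfl fun i _ => by rw [sb_gu hζ]

theorem T2' (hζ : IsPrimitiveRoot ζ 29) (u : (𝓞 K)ˣ) (hu : cj hζ (u : 𝓞 K) = u) :
    ∃ e v, u = gp hζ e * v ^ 2 ∧ cj hζ (v : 𝓞 K) = v := by
  obtain ⟨e, v, h⟩ := T2 hζ u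
  refine ⟨e, v, h, T3 hζ v ?_⟩
  rw [h, Units.val_mul, Units.val_pow_eq_pow_val, map_mul, map_pow, (sb_gp hζ 0 e).1] at hu
  exact mul_left_cancel₀ (gp hζ e).ne_zero hu

theorem sb_sq (hζ : IsPrimitiveRoot ζ 29) (j : Fin 14) {x : 𝓞 K} (hx : cj hζ x = x) (h0 : x ≠ 0) :
    sb hζ j (x ^ 2) = 0 := by
  have := sb_norm hζ j h0
  rwa [hx, ← sq] at this

def Rl : List ℕ := [1793, 1830, 854, 1304, 1932, 1346, 1188, 464, 1982, 1302, 890, 0, 0, 0]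
def kl : List ℕ := [2654, 5590, 9146]
def Sl : List ℕ := [2655, 5590, 9146]

theorem SR : ∀ i j : Fin 14, ∑ k : Fin 14, sgm i (k + 1) * bt Rl k j =
    (if i = j then 1 else 0) + (if 11 ≤ (i : ℕ) then bt kl (i - 11) j else 0) := by
  decide +kernel

def ke (a : Fin 3 → ZMod 2) (i : Fin 14) : ZMod 2 := ∑ k : Fin 3, a k * bt kl k i

theorem ke_of (e : Fin 14 → ZMod 2) (h : ∀ j : Fin 14, ∑ i : Fin 14, e i * sgm i (j + 1) = 0) :
    e = ke (fun k => e ⟨k + 11, by omega⟩) := by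
  funext j
  have h1 : ∑ k : Fin 14, (∑ i : Fin 14, e i * sgm i (k + 1)) * bt Rl k j = 0 := by
    simp [h]
  simp_rw [Finset.sum_mul, mul_assoc] at h1
  rw [Finset.sum_comm] at h1
  simp_rw [← Finset.mul_sum, SR, mul_add, Finset.sum_add_distrib] at h1
  have h2 : ∑ i : Fin 14, e i * (if i = j then 1 else 0) = e j := by simp
  have h3 : ∑ i : Fin 14, e i * (if 11 ≤ (i : ℕ) then bt kl (i - 11) j else 0) =
      ke (fun k => e ⟨k + 11, by omega⟩) j := by
    unfold ke
    simp only [Fin.sum_univ_succ, Fin.sum_univ_zero]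
    simp only [Fin.val_succ, Fin.val_zero]
    norm_num
    rfl
  rw [h2, h3] at h1
  have d : ∀ x y : ZMod 2, x + y = 0 → x = y := by decide
  exact d _ _ h1

theorem T4 (hζ : IsPrimitiveRoot ζ 29) (u : (𝓞 K)ˣ) (hu : cj hζ (u : 𝓞 K) = u)
    (hp : ∀ j, sb hζ j (u : 𝓞 K) = 0) :
    ∃ a v, u = gp hζ (ke a) * v ^ 2 ∧ cj hζ (v : 𝓞 K) = v := by
  obtain ⟨e, v, h, hv⟩ := T2' hζ u hu
  have := ke_of e (fun j => by
    have h1 := hp j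
    rw [h, Units.val_mul, Units.val_pow_eq_pow_val, sb_mul hζ j (sb_gp hζ j e).1 (by rw [map_pow, hv])
      (Units.ne_zero _) (pow_ne_zero _ v.ne_zero), sb_sq hζ j hv v.ne_zero, add_zero,
      (sb_gp hζ j e).2] at h1
    exact h1)
  rw [this] at h
  exact ⟨_, v, h, hv⟩

theorem kl12 : ∀ (k : Fin 3) (j : Fin 14), ∑ i : Fin 14, bt kl k i * (lgm i (j + 1) + lgm i (12 * (j + 1))) = 0 := by
  decide +kernel

theorem lg_tau (hζ : IsPrimitiveRoot ζ 29) {j : ℕ} (hj : ¬ 29 ∣ j) (u : (𝓞 K)ˣ) :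
    lg hζ j (Units.map (sg hζ 12 : 𝓞 K →* 𝓞 K) u) = lg hζ (12 * j) u := by
  have h1 : (h59 hζ j).comp (sg hζ 12 : 𝓞 K →+* 𝓞 K) = h59 hζ (12 * j) := by
    apply hom_ext29 hζ
    rw [h59_zeta hζ (by omega)]
    simp only [RingHom.comp_apply, RingHom.coe_coe]
    rw [sg_zeta hζ (by norm_num), map_pow, h59_zeta hζ hj, ← pow_mul, mul_comm]
  have h2 : h59 hζ j (sg hζ 12 (u : 𝓞 K)) = h59 hζ (12 * j) u := RingHom.congr_fun h1 _
  unfold lg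
  rw [← h2]; rfl

theorem T5 (hζ : IsPrimitiveRoot ζ 29) (u : (𝓞 K)ˣ) (hu : cj hζ (u : 𝓞 K) = u)
    (hp : ∀ j, sb hζ j (u : 𝓞 K) = 0) :
    ∃ v : (𝓞 K)ˣ, (u : 𝓞 K) * sg hζ 12 (u : 𝓞 K) = (v : 𝓞 K) ^ 2 ∧ cj hζ (v : 𝓞 K) = v := by
  obtain ⟨a, v, h, hv⟩ := T4 hζ u hu hp
  obtain ⟨w, hw⟩ := T1 hζ (gp hζ (ke a) * Units.map (sg hζ 12 : 𝓞 K →* 𝓞 K) (gp hζ (ke a))) (fun j => by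
    have hj := j.2
    rw [lg_mul, lg_tau hζ (by omega), lg_gp hζ (by omega), lg_gp hζ (by omega), ← Finset.sum_add_distrib]
    simp_rw [← mul_add]
    unfold ke
    simp_rw [Finset.sum_mul, mul_assoc]
    rw [Finset.sum_comm]
    simp_rw [← Finset.mul_sum, kl12]
    simp)
  have hw' := congrArg (Units.val) hw
  rw [Units.val_mul, Units.val_pow_eq_pow_val] at hw'
  change (gp hζ (ke a) : 𝓞 K) * sg hζ 12 (gp hζ (ke a) : 𝓞 K) = (w : 𝓞 K) ^ 2 at hw'
  have hg := (sb_gp hζ 0 (ke a)).1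
  have hwr : cj hζ (w : 𝓞 K) = w := by
    apply T3
    rw [← map_pow, ← hw', map_mul, hg, cj_sg hζ (by norm_num), hg]
  refine ⟨w * v * Units.map (sg hζ 12 : 𝓞 K →* 𝓞 K) v, ?_, ?_⟩
  · rw [h]; simp only [Units.val_mul, Units.val_pow_eq_pow_val, map_mul, map_pow]
    change _ = (w * v * sg hζ 12 (v : 𝓞 K)) ^ 2
    rw [mul_pow, mul_pow, ← hw']; ring
  · simp only [Units.val_mul, map_mul]
    change cj hζ _ * cj hζ _ * cj hζ (sg hζ 12 (v : 𝓞 K)) = _ * _ * sg hζ 12 (v : 𝓞 K)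
    rw [cj_sg hζ (by norm_num), hv, hwr]

theorem T6 (hζ : IsPrimitiveRoot ζ 29) {u u' v v' : (𝓞 K)ˣ} {a : Fin 3 → ZMod 2}
    (h : u = gp hζ (ke a) * v ^ 2) (h' : u' = gp hζ (ke a) * v' ^ 2)
    (hv : cj hζ (v : 𝓞 K) = v) (hv' : cj hζ (v' : 𝓞 K) = v') :
    ∃ w : (𝓞 K)ˣ, (u : 𝓞 K) * u' = (w : 𝓞 K) ^ 2 ∧ cj hζ (w : 𝓞 K) = w := by
  refine ⟨gp hζ (ke a) * v * v', ?_, ?_⟩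
  · rw [h, h']; simp only [Units.val_mul, Units.val_pow_eq_pow_val]; ring
  · simp only [Units.val_mul, map_mul]; rw [(sb_gp hζ 0 (ke a)).1, hv, hv']

noncomputable def Fs (hζ : IsPrimitiveRoot ζ 29) (k : Fin 3) (x : 𝓞 K) : ZMod 2 :=
  ∑ j : Fin 14, bt Sl k j * sb hζ j x

theorem SS : ∀ (k : Fin 3) (i : Fin 14), ∑ j : Fin 14, bt Sl k j * sgm i (j + 1) = 0 := by
  decide +kernel

theorem Fs_mul (hζ : IsPrimitiveRoot ζ 29) (k : Fin 3) {x y : 𝓞 K} (hx : cj hζ x = x)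
    (hy : cj hζ y = y) (hx0 : x ≠ 0) (hy0 : y ≠ 0) :
    Fs hζ k (x * y) = Fs hζ k x + Fs hζ k y := by
  unfold Fs
  rw [← Finset.sum_add_distrib]
  exact Finset.sum_congr rfl fun j _ => by rw [sb_mul hζ j hx hy hx0 hy0, mul_add]

theorem T7 (hζ : IsPrimitiveRoot ζ 29) (u : (𝓞 K)ˣ) (hu : cj hζ (u : 𝓞 K) = u) (k : Fin 3) :
    Fs hζ k (u : 𝓞 K) = 0 := by
  obtain ⟨e, v, h, hv⟩ := T2' hζ u hu
  rw [h, Units.val_mul, Units.val_pow_eq_pow_val, Fs_mul hζ k (sb_gp hζ 0 e).1 (by rw [map_pow, hv])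
      (Units.ne_zero _) (pow_ne_zero _ v.ne_zero)]
  have h1 : Fs hζ k ((v : 𝓞 K) ^ 2) = 0 := by
    unfold Fs; simp [sb_sq hζ _ hv v.ne_zero]
  rw [h1, add_zero]
  unfold Fs
  simp_rw [(sb_gp hζ _ e).2, Finset.mul_sum]
  rw [Finset.sum_comm]
  simp_rw [mul_left_comm, ← Finset.mul_sum, SS]
  simp

end P8

section P9
set_option linter.unusedSectionVars false
set_option linter.style.haveILetI false
set_option linter.unusedVariables false

variable {K : Type} [Field K] [NumberField K] [IsCyclotomicExtension {(29 : ℕ)} ℚ K] {ζ : 𝓞 K}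

theorem span_unit_mul {R : Type*} [CommRing R] [IsDomain R] (a : R) (u : Rˣ) :
    Ideal.span {a * (u : R)} = Ideal.span {a} :=
  Ideal.span_singleton_eq_span_singleton.mpr (Associated.symm ⟨u, rfl⟩)

theorem L7 (hζ : IsPrimitiveRoot ζ 29) {P : Ideal (𝓞 K)} (hP : P ≠ ⊥) {α π : 𝓞 K} {v : (𝓞 K)ˣ}
    (h1 : P ^ 2 = Ideal.span {α}) (h2 : P * Ideal.map (cj hζ) P = Ideal.span {π}) (hπ : cj hζ π = π)
    (hv : cj hζ (v : 𝓞 K) = v) (h3 : α * cj hζ α = π ^ 2 * (v : 𝓞 K) ^ 2) : Pr P := by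
  rw [← span_unit_mul π v] at h2
  have hp : cj hζ (π * v) = π * v := by rw [map_mul, hπ, hv]
  rw [← mul_pow] at h3
  generalize π * (v : 𝓞 K) = p at *
  by_cases hb : p + α = 0
  · apply L4 hζ P hP
    have : α = p * ((-1 : (𝓞 K)ˣ) : 𝓞 K) := by
      rw [Units.val_neg, Units.val_one]; linear_combination hb
    rw [this, span_unit_mul, ← h2, sq] at h1
    exact (mul_left_cancel₀ hP h1).symm
  have hb' : cj hζ (p + α) ≠ 0 := by
    rw [Ne, map_eq_zero_iff _ (cj hζ).injective]; exact hb
  have e1 : α * cj hζ (p + α) = p * (p + α) := by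
    rw [map_add, hp]; linear_combination h3
  have e2 : P * Ideal.span {cj hζ (p + α)} = Ideal.map (cj hζ) P * Ideal.span {p + α} := by
    apply mul_left_cancel₀ hP
    rw [← mul_assoc, ← mul_assoc, ← sq, h1, h2, Ideal.span_singleton_mul_span_singleton,
      Ideal.span_singleton_mul_span_singleton, e1]
  have hs : Ideal.span {cj hζ (p + α)} ≠ ⊥ := by
    rw [Ne, Ideal.span_singleton_eq_bot]; exact hb'
  have e3 : Pr (P * Ideal.span {cj hζ (p + α)}) := by
    apply L4 hζ _ (mul_ne_zero hP hs)
    rw [Ideal.map_mul, map_e_span, cj_cj, e2]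
  rw [mul_comm] at e3
  exact Pr.cancel (Pr.span _) hs e3

theorem udata (hζ : IsPrimitiveRoot ζ 29) {I : Ideal (𝓞 K)} (hI : I ≠ ⊥) {α : 𝓞 K}
    (h1 : I ^ 2 = Ideal.span {α}) : ∃ (π : 𝓞 K) (u : (𝓞 K)ˣ), cj hζ π = π ∧
      I * Ideal.map (cj hζ) I = Ideal.span {π} ∧ α * cj hζ α = π ^ 2 * u ∧ cj hζ (u : 𝓞 K) = u ∧
      ∀ j, sb hζ j (u : 𝓞 K) = 0 := by
  obtain ⟨π, hπ, h2⟩ := L2 hζ I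
  have hπ0 : π ≠ 0 := by
    rintro rfl
    have : I * Ideal.map (cj hζ) I ≠ ⊥ := mul_ne_zero hI (map_e_ne_bot _ hI)
    rw [h2] at this; simp at this
  have hα0 : α ≠ 0 := by
    rintro rfl
    have : I ^ 2 ≠ ⊥ := pow_ne_zero 2 hI
    rw [h1] at this; simp at this
  have h3 : Ideal.span {π ^ 2} = Ideal.span {α * cj hζ α} := by
    rw [← Ideal.span_singleton_pow, ← h2, ← Ideal.span_singleton_mul_span_singleton, ← map_e_span, ← h1,
      Ideal.map_pow, mul_pow]
  obtain ⟨u, hu⟩ := Ideal.span_singleton_eq_span_singleton.mp h3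
  have hur : cj hζ (u : 𝓞 K) = u := by
    have := congrArg (cj hζ) hu
    rw [map_mul, map_pow, hπ, map_mul, cj_cj, mul_comm (cj hζ α), ← hu] at this
    exact mul_left_cancel₀ (pow_ne_zero 2 hπ0) this
  refine ⟨π, u, hπ, h2, hu.symm, hur, fun j => ?_⟩
  have := sb_norm hζ j hα0
  rwa [← hu, sb_mul hζ j (by rw [map_pow, hπ]) hur (pow_ne_zero 2 hπ0) u.ne_zero, sb_sq hζ j hπ hπ0,
    zero_add] at this

theorem cj_map_sg (hζ : IsPrimitiveRoot ζ 29) {c : ℕ} (hc : ¬ 29 ∣ c) (I : Ideal (𝓞 K)) :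
    Ideal.map (cj hζ) (Ideal.map (sg hζ c) I) = Ideal.map (sg hζ c) (Ideal.map (cj hζ) I) := by
  rw [map_e_comp (e := cj hζ) (f := sg hζ c) (g := (sg hζ c).trans (cj hζ)) (fun x => rfl),
    map_e_comp (e := sg hζ c) (f := cj hζ) (g := (sg hζ c).trans (cj hζ))]
  intro x
  exact (cj_sg hζ hc x).symm

theorem sg_map_sg (hζ : IsPrimitiveRoot ζ 29) {a b c : ℕ} (ha : ¬ 29 ∣ a) (hb : ¬ 29 ∣ b)
    (h : a * b % 29 = c % 29) (I : Ideal (𝓞 K)) :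
    Ideal.map (sg hζ a) (Ideal.map (sg hζ b) I) = Ideal.map (sg hζ c) I :=
  map_e_comp (fun x => sg_sg hζ ha hb h x) I

theorem map_sg_one (hζ : IsPrimitiveRoot ζ 29) (I : Ideal (𝓞 K)) : Ideal.map (sg hζ 1) I = I := by
  ext x; rw [mem_map_e]; simp [sg_one]

theorem L8 (hζ : IsPrimitiveRoot ζ 29) {I : Ideal (𝓞 K)} (hI : I ≠ ⊥) (h : Pr (I ^ 2)) :
    Pr (I * Ideal.map (sg hζ 12) I) := by
  obtain ⟨α, h1⟩ := h
  obtain ⟨π, u, hπ, h2, h3, hu, hs⟩ := udata hζ hI h1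
  obtain ⟨v, hv, hvr⟩ := T5 hζ u hu hs
  refine L7 hζ (mul_ne_zero hI (map_e_ne_bot _ hI)) (α := α * sg hζ 12 α) (π := π * sg hζ 12 π) (v := v)
    ?_ ?_ ?_ hvr ?_
  · rw [mul_pow, ← Ideal.map_pow, h1, map_e_span, Ideal.span_singleton_mul_span_singleton]
  · rw [Ideal.map_mul, cj_map_sg hζ (by norm_num), mul_mul_mul_comm, ← Ideal.map_mul, h2, map_e_span,
      Ideal.span_singleton_mul_span_singleton]
  · rw [map_mul, cj_sg hζ (by norm_num), hπ]
  · have h4 := congrArg (sg hζ 12) h3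
    rw [map_mul, map_mul, map_pow] at h4
    rw [map_mul, cj_sg hζ (by norm_num), ← hv]
    linear_combination h3 * (sg hζ 12 α * sg hζ 12 (cj hζ α)) + π ^ 2 * u * h4

theorem L8b (hζ : IsPrimitiveRoot ζ 29) {I : Ideal (𝓞 K)} (hI : I ≠ ⊥) (h : Pr (I ^ 4)) :
    Pr (I ^ 2) := by
  have h1 := L8 hζ (pow_ne_zero 2 hI) (by rwa [← pow_mul] : Pr ((I ^ 2) ^ 2))
  rw [Ideal.map_pow, ← mul_pow] at h1
  have h2 := L8 hζ (mul_ne_zero hI (map_e_ne_bot _ hI)) h1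
  rw [Ideal.map_mul, sg_map_sg hζ (c := 28) (by norm_num) (by norm_num) (by norm_num)] at h2
  change Pr (I * _ * (_ * Ideal.map (cj hζ) I)) at h2
  have h3 : I * Ideal.map (sg hζ 12) I * (Ideal.map (sg hζ 12) I * Ideal.map (cj hζ) I) =
    (I * Ideal.map (cj hζ) I) * (Ideal.map (sg hζ 12) I) ^ 2 := by ring
  rw [h3] at h2
  obtain ⟨π, -, hp⟩ := L2 hζ I
  have h4 := Pr.cancel ⟨π, hp⟩ (mul_ne_zero hI (map_e_ne_bot _ hI)) h2
  have h5 := h4.map (sg hζ 17)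
  rw [Ideal.map_pow, sg_map_sg hζ (c := 1) (by norm_num) (by norm_num) (by norm_num)] at h5
  rwa [map_sg_one] at h5

theorem L8c (hζ : IsPrimitiveRoot ζ 29) (k : ℕ) {I : Ideal (𝓞 K)} (hI : I ≠ ⊥)
    (h : Pr (I ^ (2 ^ k))) : Pr (I ^ 2) := by
  induction k generalizing I with
  | zero => exact (by simpa using h : Pr I).pow 2
  | succ k ih =>
    apply L8b hζ hI
    rw [pow_succ', pow_mul] at h
    have := ih (pow_ne_zero 2 hI) h
    rwa [← pow_mul] at this

end P9

section P10
set_option linter.unusedSectionVars false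
set_option linter.style.haveILetI false
set_option linter.unusedVariables false

variable {K : Type} [Field K] [NumberField K] [IsCyclotomicExtension {(29 : ℕ)} ℚ K] {ζ : 𝓞 K}

theorem sum_poly_zero {F : Type} [Field F] [Fintype F] {a b k : ℕ}
    (h : (a + b) * k < Fintype.card F - 1) : ∑ x : F, x ^ (a * k) * (1 - x) ^ (b * k) = 0 := by
  classical
  let f : Polynomial F := Polynomial.X ^ (a * k) * (1 - Polynomial.X) ^ (b * k)
  have hd : f.natDegree < Fintype.card F - 1 := by
    refine lt_of_le_of_lt ?_ h
    have h1 : (1 - Polynomial.X : Polynomial F).natDegree ≤ 1 := by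
      refine (Polynomial.natDegree_sub_le _ _).trans ?_
      simp
    calc f.natDegree ≤ _ := Polynomial.natDegree_mul_le
      _ ≤ a * k + b * k * 1 := by
        gcongr
        · exact Polynomial.natDegree_X_pow_le _
        · exact Polynomial.natDegree_pow_le.trans (Nat.mul_le_mul_left _ h1)
      _ = (a + b) * k := by ring
  have h2 : ∀ x : F, x ^ (a * k) * (1 - x) ^ (b * k) = ∑ i ∈ Finset.range (Fintype.card F - 1), f.coeff i * x ^ i := by
    intro x
    rw [← Polynomial.eval_eq_sum_range' hd]
    simp [f]
  simp_rw [h2]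
  rw [Finset.sum_comm]
  apply Finset.sum_eq_zero
  intro i hi
  rw [← Finset.mul_sum, FiniteField.sum_pow_lt_card_sub_one F i (Finset.mem_range.mp hi), mul_zero]

theorem jac_char (hζ : IsPrimitiveRoot ζ 29) {F : Type} [Field F] [Fintype F] [DecidableEq F]
    (φ : 𝓞 K →+* F) (hr : IsPrimitiveRoot (φ ζ) 29) {k : ℕ} (hk : Fintype.card F - 1 = 29 * k) :
    ∃ χ : MulChar F (𝓞 K), (∀ x, φ (χ x) = x ^ k) ∧ χ ^ 29 = 1 ∧ χ ≠ 1 := by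
  obtain ⟨g, hg⟩ := IsCyclic.exists_generator (α := Fˣ)
  have hcard : Fintype.card Fˣ = 29 * k := by rw [Fintype.card_units, hk]
  have hk0 : k ≠ 0 := by
    rintro rfl
    have := Fintype.one_lt_card (α := F)
    omega
  have h1 : ((g : F) ^ k) ^ 29 = 1 := by
    rw [← pow_mul, mul_comm, ← hcard, ← Units.val_pow_eq_pow_val, pow_card_eq_one, Units.val_one]
  obtain ⟨s, hs, hs2⟩ := hr.eq_pow_of_pow_eq_one h1
  have hzu := hζ.isUnit (by norm_num)
  have hmem : hzu.unit ^ s ∈ rootsOfUnity (Fintype.card Fˣ) (𝓞 K) := by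
    rw [mem_rootsOfUnity, hcard]
    apply Units.ext
    rw [Units.val_pow_eq_pow_val, Units.val_pow_eq_pow_val, Units.val_one, IsUnit.unit_spec, ← pow_mul, show s * (29 * k) = 29 * (s * k) by ring, pow_mul, hζ.pow_eq_one, one_pow]
  have hspec := MulChar.ofRootOfUnity_spec hmem hg
  set χ : MulChar F (𝓞 K) := MulChar.ofRootOfUnity hmem hg
  have hspec' : χ (g : F) = ζ ^ s := by rw [hspec]; push_cast; rw [IsUnit.unit_spec]
  have hall : ∀ x : Fˣ, ∃ n : ℕ, x = g ^ n := fun x => by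
    obtain ⟨n, hn⟩ := (Submonoid.mem_powers_iff _ _).mp ((mem_powers_iff_mem_zpowers).mpr (hg x))
    exact ⟨n, hn.symm⟩
  refine ⟨χ, fun x => ?_, ?_, ?_⟩
  · by_cases hx : x = 0
    · rw [hx, MulChar.map_zero, map_zero, zero_pow hk0]
    · obtain ⟨n, hn⟩ := hall (Units.mk0 x hx)
      have : x = (g : F) ^ n := by
        rw [← Units.val_pow_eq_pow_val, ← hn]; rfl
      rw [this, map_pow, hspec', map_pow, map_pow, hs2]
      ring
  · rw [MulChar.eq_one_iff]
    intro a
    obtain ⟨n, rfl⟩ := hall a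
    rw [MulChar.pow_apply_coe, Units.val_pow_eq_pow_val, map_pow, hspec', ← pow_mul, ← pow_mul,
      show s * (n * 29) = 29 * (s * n) by ring, pow_mul, hζ.pow_eq_one, one_pow]
  · intro h
    have h2 : χ (g : F) = 1 := by rw [h, MulChar.one_apply_coe]
    have h3 : (g : F) ^ k = 1 := by
      rw [← hs2, ← map_pow, ← hspec', h2, map_one]
    have h4 : g ^ k = 1 := by ext; push_cast; exact h3
    have h5 := orderOf_dvd_of_pow_eq_one h4
    rw [orderOf_eq_card_of_forall_mem_zpowers hg, Nat.card_eq_fintype_card, hcard] at h5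
    have := Nat.le_of_dvd (Nat.pos_of_ne_zero hk0) h5
    omega

theorem root_sg (hζ : IsPrimitiveRoot ζ 29) {x : 𝓞 K} (hx : x ^ 29 = 1) {c : ℕ} (hc : ¬ 29 ∣ c) :
    sg hζ c x = x ^ c := by
  obtain ⟨m, -, rfl⟩ := hζ.eq_pow_of_pow_eq_one hx
  rw [map_pow, sg_zeta hζ hc, ← pow_mul, ← pow_mul, mul_comm]

theorem comp_sg (hζ : IsPrimitiveRoot ζ 29) {F : Type} [Field F] {χ : MulChar F (𝓞 K)} (h : χ ^ 29 = 1)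
    {c : ℕ} (hc : ¬ 29 ∣ c) : χ.ringHomComp (sg hζ c : 𝓞 K →+* 𝓞 K) = χ ^ c := by
  refine MulChar.ext fun a => ?_
  rw [MulChar.ringHomComp_apply, MulChar.pow_apply_coe]
  apply root_sg hζ _ hc
  rw [← MulChar.pow_apply_coe, h, MulChar.one_apply_coe]

theorem jac_main (hζ : IsPrimitiveRoot ζ 29) {F : Type} [Field F] [Fintype F] [DecidableEq F]
    (φ : 𝓞 K →+* F) (hr : IsPrimitiveRoot (φ ζ) 29) :
    ∃ J : 𝓞 K, J * cj hζ J = (Fintype.card F : 𝓞 K) ∧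
      ∀ c, 0 < c → c < 29 → c + 2 * c % 29 < 29 → φ (sg hζ c J) = 0 := by
  have h29 : 29 ∣ Fintype.card F - 1 := by
    rw [hr.eq_orderOf]
    apply orderOf_dvd_of_pow_eq_one
    exact FiniteField.pow_card_sub_one_eq_one _ (hr.ne_zero (by norm_num))
  obtain ⟨k, hk⟩ := h29
  obtain ⟨χ, hχ, h1, hne⟩ := jac_char hζ φ hr hk
  have hord : orderOf χ = 29 := by
    haveI : Fact (Nat.Prime 29) := ⟨by norm_num⟩
    exact orderOf_eq_prime h1 hne
  have hpow : ∀ n : ℕ, ¬ 29 ∣ n → χ ^ n ≠ 1 := fun n hn h => hn (hord ▸ orderOf_dvd_of_pow_eq_one h)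
  have h12 : (χ ^ 2) ^ 29 = 1 := by rw [← pow_mul, mul_comm, pow_mul, h1, one_pow]
  have hJ : ∀ c, ¬ 29 ∣ c → sg hζ c (jacobiSum χ (χ ^ 2)) = jacobiSum (χ ^ c) ((χ ^ 2) ^ c) := by
    intro c hc
    rw [← comp_sg hζ h1 hc, ← comp_sg hζ h12 hc, jacobiSum_ringHomComp]; rfl
  refine ⟨jacobiSum χ (χ ^ 2), ?_, ?_⟩
  · unfold cj
    rw [hJ 28 (by norm_num)]
    have e1 : χ ^ 28 = χ⁻¹ := by
      rw [eq_inv_iff_mul_eq_one, ← pow_succ]; exact h1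
    have e2 : (χ ^ 2) ^ 28 = (χ ^ 2)⁻¹ := by
      rw [eq_inv_iff_mul_eq_one, ← pow_succ]; exact h12
    rw [e1, e2]
    have hinj : Function.Injective (algebraMap (𝓞 K) K) := FaithfulSMul.algebraMap_injective _ _
    apply hinj
    have hchar : ringChar K ≠ ringChar F := by
      rw [ringChar.eq K 0]
      intro h
      haveI := ringChar.charP F
      rw [← h] at this
      haveI := CharP.charP_to_charZero F
      exact not_finite F
    have := jacobiSum_mul_jacobiSum_inv hchar (χ := χ.ringHomComp (algebraMap (𝓞 K) K))
      (φ := (χ ^ 2).ringHomComp (algebraMap (𝓞 K) K))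
      ((MulChar.ringHomComp_ne_one_iff hinj).mpr hne)
      ((MulChar.ringHomComp_ne_one_iff hinj).mpr (hpow 2 (by norm_num)))
      (by rw [← MulChar.ringHomComp_mul]
          refine (MulChar.ringHomComp_ne_one_iff hinj).mpr ?_
          rw [← pow_succ']
          exact hpow 3 (by norm_num))
    rw [MulChar.ringHomComp_inv, MulChar.ringHomComp_inv, jacobiSum_ringHomComp,
      jacobiSum_ringHomComp] at this
    rw [map_mul, this, map_natCast]
  · intro c hc0 hc1 hc2
    rw [hJ c (by omega), ← pow_mul]
    have e3 : χ ^ (2 * c) = χ ^ (2 * c % 29) := by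
      rw [← pow_mod_orderOf, hord]
    rw [e3]
    have hb0 : 2 * c % 29 ≠ 0 := by omega
    generalize 2 * c % 29 = b at *
    unfold jacobiSum
    rw [map_sum]
    have : ∀ x : F, φ ((χ ^ c) x * (χ ^ b) (1 - x)) = x ^ (c * k) * (1 - x) ^ (b * k) := by
      intro x
      rw [MulChar.pow_apply' _ (by omega), MulChar.pow_apply' _ hb0, map_mul, map_pow, map_pow, hχ, hχ,
        ← pow_mul, ← pow_mul, mul_comm k, mul_comm k]
    simp_rw [this]
    apply sum_poly_zero
    rw [hk]
    have hk0 : 0 < k := by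
      have := Fintype.one_lt_card (α := F)
      rcases Nat.eq_zero_or_pos k with h | h
      · rw [h] at hk; omega
      · exact h
    exact Nat.mul_lt_mul_of_pos_right hc2 hk0

end P10

section P11
set_option linter.unusedSectionVars false
set_option linter.style.haveILetI false
set_option linter.unusedVariables false

variable {K : Type} [Field K] [NumberField K] [IsCyclotomicExtension {(29 : ℕ)} ℚ K] {ζ : 𝓞 K}

/-- class of an ideal, additively -/
noncomputable def cl (I : Ideal (𝓞 K)) : Additive (ClassGroup (𝓞 K)) :=
  open scoped Classical in
  if h : I ≠ ⊥ then Additive.ofMul (ClassGroup.mk0 ⟨I, mem_nonZeroDivisors_of_ne_zero h⟩) else 0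

theorem cl_mul {I J : Ideal (𝓞 K)} (hI : I ≠ ⊥) (hJ : J ≠ ⊥) : cl (I * J) = cl I + cl J := by
  have h : I * J ≠ ⊥ := mul_ne_zero hI hJ
  rw [cl, cl, cl, dif_pos h, dif_pos hI, dif_pos hJ, ← ofMul_mul, ← map_mul]
  rfl

theorem cl_zero_iff {I : Ideal (𝓞 K)} (hI : I ≠ ⊥) : cl I = 0 ↔ Pr I := by
  rw [cl, dif_pos hI, ofMul_eq_zero, ClassGroup.mk0_eq_one_iff, Submodule.isPrincipal_iff]
  rfl

theorem cl_one : cl (1 : Ideal (𝓞 K)) = 0 :=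
  (cl_zero_iff one_ne_zero).mpr ⟨1, by rw [Ideal.one_eq_top, Ideal.span_singleton_one]⟩

theorem cl_pow {I : Ideal (𝓞 K)} (hI : I ≠ ⊥) (n : ℕ) : cl (I ^ n) = n • cl I := by
  induction n with
  | zero => rw [pow_zero, zero_nsmul, cl_one]
  | succ n ih => rw [pow_succ, cl_mul (pow_ne_zero n hI) hI, ih, succ_nsmul]

theorem cl_prod {ι : Type*} (s : Finset ι) (f : ι → Ideal (𝓞 K)) (h : ∀ i ∈ s, f i ≠ ⊥) :
    cl (∏ i ∈ s, f i) = ∑ i ∈ s, cl (f i) := by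
  classical
  induction s using Finset.induction_on with
  | empty => rw [Finset.prod_empty, Finset.sum_empty, cl_one]
  | insert a s ha ih =>
    rw [Finset.prod_insert ha, Finset.sum_insert ha,
      cl_mul (h a (Finset.mem_insert_self _ _))
        (Finset.prod_ne_zero_iff.mpr fun i hi => h i (Finset.mem_insert_of_mem hi)),
      ih fun i hi => h i (Finset.mem_insert_of_mem hi)]

def Tp : Finset ℕ := {1,2,5,6,10,11,12,13,15,20,21,22,25,26}

def Bm (c : ℕ) (d : Fin 14) : ℤ := if c = d + 1 then 1 else if c = 28 - d then -1 else 0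

def ms : Fin 14 → ℤ := ![-1,1,0,0,0,1,1,0,1,0,1,-1,0,-1]

theorem ms_cert : ∀ d : Fin 14, ∑ a : Fin 14, ms a * ∑ c ∈ Tp, Bm ((a + 1) * c % 29) d =
    if d = 0 then 4 else 0 := by decide +kernel

theorem stick {G : Type*} [AddCommGroup G] (f : ℕ → G) (hneg : ∀ c, 0 < c → c < 29 → f (29 - c) = - f c)
    (hrel : ∀ a, 0 < a → a < 29 → ∑ c ∈ Tp, f (a * c % 29) = 0) : 4 • f 1 = 0 := by
  have hB : ∀ c, 0 < c → c < 29 → f c = ∑ d : Fin 14, Bm c d • f (d + 1) := by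
    intro c h0 h1
    by_cases hc : c ≤ 14
    · rw [Finset.sum_eq_single (⟨c - 1, by omega⟩ : Fin 14)]
      · have : c = c - 1 + 1 := by omega
        rw [Bm, if_pos this, one_smul]; exact congrArg f this
      · intro d _ hd
        have : (d : ℕ) ≠ c - 1 := fun h => hd (Fin.ext h)
        have := d.2
        rw [Bm, if_neg (by omega), if_neg (by omega), zero_smul]
      · simp
    · rw [Finset.sum_eq_single (⟨28 - c, by omega⟩ : Fin 14)]
      · have h2 := hneg (29 - c) (by omega) (by omega)
        rw [Bm, if_neg (by simp only; omega), if_pos (by simp only; omega)]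
        rw [show 29 - (29 - c) = c by omega] at h2
        rw [neg_one_zsmul, h2]
        congr 2; simp only; omega
      · intro d _ hd
        have : (d : ℕ) ≠ 28 - c := fun h => hd (Fin.ext h)
        have := d.2
        rw [Bm, if_neg (by omega), if_neg (by omega), zero_smul]
      · simp
  have h1 : ∑ a : Fin 14, ms a • ∑ c ∈ Tp, f (((a : ℕ) + 1) * c % 29) = 0 := by
    apply Finset.sum_eq_zero
    intro a _
    rw [hrel _ (by omega) (by omega), smul_zero]
  have hT : ∀ c ∈ Tp, ¬ 29 ∣ c := by decide
  have h2 : ∀ a : Fin 14, ∑ c ∈ Tp, f (((a : ℕ) + 1) * c % 29) =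
      ∑ d : Fin 14, (∑ c ∈ Tp, Bm ((a + 1) * c % 29) d) • f (d + 1) := by
    intro a
    simp_rw [Finset.sum_smul]
    rw [Finset.sum_comm]
    refine Finset.sum_congr rfl fun c hc => hB _ ?_ (Nat.mod_lt _ (by norm_num))
    rw [Nat.pos_iff_ne_zero]
    intro h
    rcases (Nat.Prime.dvd_mul (by norm_num)).mp (Nat.dvd_of_mod_eq_zero h) with h | h
    · have := Nat.le_of_dvd (by omega) h
      omega
    · exact hT c hc h
  simp_rw [h2, Finset.smul_sum, smul_smul] at h1
  rw [Finset.sum_comm] at h1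
  simp_rw [← Finset.sum_smul, ms_cert] at h1
  rw [Finset.sum_eq_single 0 (fun d _ hd => by rw [if_neg hd, zero_smul]) (by simp), if_pos rfl] at h1
  rw [← natCast_zsmul]; simpa using h1

theorem zeta_int {P : Ideal (𝓞 K)} {p : ℕ} (hp : p.Prime) (hN : Ideal.absNorm P = p) (x : 𝓞 K) :
    ∃ n : ℤ, x - n ∈ P := by
  haveI : Fact p.Prime := ⟨hp⟩
  have hc : Nat.card (𝓞 K ⧸ P) = p := by
    rw [← hN, Ideal.absNorm_apply, Submodule.cardQuot_apply]
  have h1 : (1 : 𝓞 K ⧸ P) ≠ 0 := by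
    intro h
    have : Nat.card (𝓞 K ⧸ P) = 1 := by
      haveI := subsingleton_of_zero_eq_one h.symm
      haveI : Nonempty (𝓞 K ⧸ P) := ⟨0⟩
      exact Nat.card_unique
    rw [hc] at this
    exact hp.one_lt.ne' this
  have := mem_zmultiples_of_prime_card hc h1 (g' := Ideal.Quotient.mk P x)
  obtain ⟨n, hn⟩ := AddSubgroup.mem_zmultiples_iff.mp this
  refine ⟨n, Ideal.Quotient.eq_zero_iff_mem.mp ?_⟩
  rw [map_sub, ← hn]
  simp

theorem conj_ne (hζ : IsPrimitiveRoot ζ 29) {P : Ideal (𝓞 K)} (hP : P.IsPrime) (h29 : (29 : 𝓞 K) ∉ P)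
    {p : ℕ} (hp : p.Prime) (hN : Ideal.absNorm P = p) {c d : ℕ} (hc : c < 29) (hd : d < 29)
    (hc0 : 0 < c) (hcd : c < d)
    (h : Ideal.map (sg hζ c) P = Ideal.map (sg hζ d) P) : False := by
  obtain ⟨n, hn⟩ := zeta_int hp hN ζ
  have h1 := (map_e_mem (sg hζ c)).mpr hn
  have h2 := (map_e_mem (sg hζ d)).mpr hn
  rw [← h] at h2
  rw [map_sub, map_intCast, sg_zeta hζ (by omega)] at h1 h2
  haveI := map_e_prime (sg hζ c) hP
  have h3 := Ideal.sub_mem _ h2 h1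
  have h29' : (29 : 𝓞 K) ∉ Ideal.map (sg hζ c) P := by
    intro h
    apply h29
    rw [← map_e_mem (sg hζ c)]
    rwa [map_ofNat]
  have h4 : ζ ^ c * (ζ ^ (d - c) - 1) ∈ Ideal.map (sg hζ c) P := by
    convert h3 using 1
    rw [mul_sub, ← pow_add, show c + (d - c) = d by omega]; ring
  rcases this.mem_or_mem h4 with h5 | h5
  · exact this.ne_top (Ideal.eq_top_of_isUnit_mem _ h5 ((hζ.isUnit (by norm_num)).pow c))
  · have := zeta_pow_mem hζ h29' h5
    omega

theorem jac_ideal (hζ : IsPrimitiveRoot ζ 29) {P : Ideal (𝓞 K)} (hP : P.IsPrime) (hP0 : P ≠ ⊥)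
    (h29 : (29 : 𝓞 K) ∉ P) {p : ℕ} (hp : p.Prime) (hN : Ideal.absNorm P = p) :
    Pr (∏ c ∈ Tp, Ideal.map (sg hζ c) P) := by
  classical
  haveI hmax := hP.isMaximal hP0
  letI := Ideal.Quotient.field P
  haveI : Finite (𝓞 K ⧸ P) := by
    apply Nat.finite_of_card_ne_zero
    have : Nat.card (𝓞 K ⧸ P) = p := by
      rw [← hN, Ideal.absNorm_apply, Submodule.cardQuot_apply]
    rw [this]; exact hp.ne_zero
  letI := Fintype.ofFinite (𝓞 K ⧸ P)
  have hcard : Fintype.card (𝓞 K ⧸ P) = p := by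
    rw [← Nat.card_eq_fintype_card, ← hN, Ideal.absNorm_apply, Submodule.cardQuot_apply]
  have hr : IsPrimitiveRoot (Ideal.Quotient.mk P ζ) 29 := by
    haveI : Fact (Nat.Prime 29) := ⟨by norm_num⟩
    rw [IsPrimitiveRoot.iff_orderOf]
    apply orderOf_eq_prime
    · rw [← map_pow, hζ.pow_eq_one, map_one]
    · intro h
      have : 29 ∣ 1 := zeta_pow_mem hζ h29 (by
        rw [pow_one, ← Ideal.Quotient.eq_zero_iff_mem, map_sub, h, map_one, sub_self])
      omega
  obtain ⟨J, hJ1, hJ2⟩ := jac_main hζ (Ideal.Quotient.mk P) hr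
  rw [hcard] at hJ1
  refine ⟨J, ?_⟩
  have hT1 : ∀ c ∈ Tp, ¬ 29 ∣ c := by decide
  have hT2 : ∀ c ∈ Tp, 0 < c ∧ c < 29 := by decide
  have hT3 : ∀ c ∈ Tp, 0 < c ^ 27 % 29 ∧ c * (c ^ 27 % 29) % 29 = 1 ∧ c ^ 27 % 29 + 2 * (c ^ 27 % 29) % 29 < 29 := by
    decide
  have hinj : Set.InjOn (fun c => Ideal.map (sg hζ c) P) (Tp : Set ℕ) := by
    intro c hc d hd hcd
    obtain ⟨c0, c1⟩ := hT2 c hc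
    obtain ⟨d0, d1⟩ := hT2 d hd
    rcases lt_trichotomy c d with h | h | h
    · exact (conj_ne hζ hP h29 hp hN c1 d1 c0 h hcd).elim
    · exact h
    · exact (conj_ne hζ hP h29 hp hN d1 c1 d0 h hcd.symm).elim
  have hmem : ∀ c ∈ Tp, J ∈ Ideal.map (sg hζ c) P := by
    intro c hc
    obtain ⟨a, b, d⟩ := hT3 c hc
    have hb : c ^ 27 % 29 < 29 := Nat.mod_lt _ (by norm_num)
    generalize c ^ 27 % 29 = e at *
    have := hJ2 e a hb d
    rw [Ideal.Quotient.eq_zero_iff_mem, ← map_e_mem (sg hζ c),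
      sg_sg hζ (hT1 c hc) (by omega) (c := 1) (by omega), sg_one] at this
    exact this
  have hdvd : ∏ c ∈ Tp, Ideal.map (sg hζ c) P ∣ Ideal.span {J} := by
    have := Finset.prod_primes_dvd (s := Tp.image (fun c => Ideal.map (sg hζ c) P)) (Ideal.span {J})
      (fun a ha => by
        obtain ⟨c, hc, rfl⟩ := Finset.mem_image.mp ha
        haveI := map_e_prime (sg hζ c) hP
        exact Ideal.prime_of_isPrime (map_e_ne_bot _ hP0) this)
      (fun a ha => by
        obtain ⟨c, hc, rfl⟩ := Finset.mem_image.mp ha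
        rw [Ideal.dvd_span_singleton]
        exact hmem c hc)
    rwa [Finset.prod_image hinj] at this
  have hJ0 : J ≠ 0 := by
    rintro rfl
    rw [zero_mul] at hJ1
    exact hp.ne_zero (by exact_mod_cast hJ1.symm)
  symm
  apply ideal_eq_of_le (Ideal.le_of_dvd hdvd)
  · rwa [Ne, Ideal.span_singleton_eq_bot]
  · have e1 : Ideal.absNorm (∏ c ∈ Tp, Ideal.map (sg hζ c) P) = p ^ 14 := by
      rw [map_prod]
      simp_rw [absNorm_map_e, hN]
      rw [Finset.prod_const]; rfl
    have e2 : Ideal.absNorm (Ideal.span {J}) = p ^ 14 := by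
      rw [Ideal.absNorm_span_singleton]
      have := congrArg (Algebra.norm ℤ) hJ1
      rw [map_mul, cj, norm_sg hζ (by norm_num)] at this
      have h3 : Algebra.norm ℤ ((p : ℕ) : 𝓞 K) = (p : ℤ) ^ 28 := by
        have := Algebra.norm_algebraMap (S := 𝓞 K) (p : ℤ)
        rw [RingOfIntegers.rank, finrank29] at this
        simpa using this
      rw [h3] at this
      have h4 := congrArg Int.natAbs this
      rw [Int.natAbs_mul, Int.natAbs_pow, Int.natAbs_natCast, show p ^ 28 = p ^ 14 * p ^ 14 by ring] at h4
      exact Nat.mul_self_inj.mp h4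
    rw [e1, e2]

theorem map_e_prod (e : 𝓞 K ≃+* 𝓞 K) (s : Finset ℕ) (f : ℕ → Ideal (𝓞 K)) :
    Ideal.map e (∏ c ∈ s, f c) = ∏ c ∈ s, Ideal.map e (f c) :=
  map_prod (Ideal.mapHom e) f s

theorem L9 (hζ : IsPrimitiveRoot ζ 29) {P : Ideal (𝓞 K)} (hP : P.IsPrime) (hP0 : P ≠ ⊥)
    (h29 : (29 : 𝓞 K) ∉ P) {p : ℕ} (hp : p.Prime) (hN : Ideal.absNorm P = p) : Pr (P ^ 2) := by
  have hT1 : ∀ c ∈ Tp, ¬ 29 ∣ c := by decide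
  have hne : ∀ c, Ideal.map (sg hζ c) P ≠ ⊥ := fun c => map_e_ne_bot _ hP0
  have h4 := stick (fun c => cl (Ideal.map (sg hζ c) P)) ?_ ?_
  · rw [map_sg_one, ← cl_pow hP0, cl_zero_iff (pow_ne_zero 4 hP0)] at h4
    exact L8b hζ hP0 h4
  · intro c h0 h1
    rw [eq_neg_iff_add_eq_zero, ← cl_mul (hne _) (hne _), cl_zero_iff (mul_ne_zero (hne _) (hne _)), mul_comm]
    obtain ⟨p, -, hp⟩ := L2 hζ (Ideal.map (sg hζ c) P)
    refine ⟨p, ?_⟩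
    rw [← hp, cj, sg_map_sg hζ (c := 29 - c) (by norm_num) (by omega) (by omega)]
  · intro a h0 h1
    have h2 := (jac_ideal hζ hP hP0 h29 hp hN).map (sg hζ a)
    rw [map_e_prod] at h2
    have h3 := (cl_zero_iff (Finset.prod_ne_zero_iff.mpr fun c _ => map_e_ne_bot _ (hne c))).mpr h2
    rw [cl_prod _ _ (fun c _ => map_e_ne_bot _ (hne c))] at h3
    rw [← h3]
    refine Finset.sum_congr rfl fun c hc => ?_
    rw [sg_map_sg hζ (c := a * c % 29) (by omega) (hT1 c hc) (by omega)]

end P11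

section P12
set_option linter.unusedSectionVars false
set_option linter.style.haveILetI false
set_option linter.unusedVariables false

variable {K : Type} [Field K] [NumberField K] [IsCyclotomicExtension {(29 : ℕ)} ℚ K] {ζ : 𝓞 K}

theorem residues : ∀ r < 29, r = 0 ∨ (∃ k < 15, r ^ k % 29 = 28) ∨ r = 1 ∨
    ((r = 7 ∨ r = 16 ∨ r = 20 ∨ r = 23 ∨ r = 24 ∨ r = 25) ∧ ∀ f < 7, f = 0 ∨ r ^ f % 29 ≠ 1) := by
  decide +kernel

theorem pow_le_card {F : Type} [Field F] [Fintype F] {p : ℕ} (hp : 1 < p) (h : ∀ x : F, x ^ p = x) :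
    Fintype.card F ≤ p := by
  classical
  have hne := FiniteField.X_pow_card_sub_X_ne_zero F hp
  have hd := FiniteField.X_pow_card_sub_X_natDegree_eq F hp
  have := Polynomial.card_le_degree_of_subset_roots (p := (Polynomial.X ^ p - Polynomial.X : Polynomial F))
    (Z := Finset.univ) (by
      intro x _
      rw [Polynomial.mem_roots hne]
      simp [h x])
  rw [hd] at this
  simpa using this

theorem gen_of_norm (hζ : IsPrimitiveRoot ζ 29) {Q : Ideal (𝓞 K)} (hQ : Q.IsPrime) (hQ0 : Q ≠ ⊥) {p f : ℕ}
    (hN : Ideal.absNorm Q = p ^ f) (hf : 7 ≤ f) (hpQ : (p : 𝓞 K) ∈ Q) (hp0 : p ≠ 0) {x : 𝓞 K}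
    (hx : Algebra.norm ℤ x = (p : ℤ) ^ 7) : Pr Q := by
  have h1 : ∏ c ∈ Finset.Icc 1 28, sg hζ c x ∈ Q := by
    rw [← norm29_prod, hx]
    push_cast
    exact Ideal.pow_mem_of_mem _ hpQ 7 (by norm_num)
  obtain ⟨c, hc, h2⟩ := (hQ.prod_mem_iff).mp h1
  refine ⟨sg hζ c x, ?_⟩
  symm
  rw [Finset.mem_Icc] at hc
  have h3 := norm_sg hζ (c := c) (by omega) x
  have hx0 : sg hζ c x ≠ 0 := by
    intro h
    rw [h, hx, Algebra.norm_zero] at h3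
    exact hp0 (by exact_mod_cast (pow_eq_zero_iff (by norm_num)).mp h3.symm)
  apply ideal_eq_of_le
  · rwa [Ideal.span_singleton_le_iff_mem]
  · rwa [Ne, Ideal.span_singleton_eq_bot]
  · rw [Ideal.absNorm_span_singleton, h3, hx, hN, Int.natAbs_pow, Int.natAbs_natCast]
    exact pow_dvd_pow _ hf

theorem prime_sq (hζ : IsPrimitiveRoot ζ 29) {Q : Ideal (𝓞 K)} (hQ : Q.IsPrime) (hQ0 : Q ≠ ⊥)
    (hB : Ideal.absNorm Q < 29 ^ 7) : Pr (Q ^ 2) := by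
  classical
  have n23 : Algebra.norm ℤ (ev (fun k => ζ ^ k) [(1,1),(1,7),(1,16),(1,20),(1,23),(1,24),(1,25)]) = 23 ^ 7 :=
    norm_ev hζ (by decide +kernel)
  have n7 : Algebra.norm ℤ (ev (fun k => ζ ^ k) [(1,0),(1,1),(1,7),(1,16),(1,20),(1,23),(1,24),(1,25)]) = 7 ^ 7 :=
    norm_ev hζ (by decide +kernel)
  by_cases h29 : (29 : 𝓞 K) ∈ Q
  · exact Pr.pow ⟨_, over29 hζ hQ h29⟩ 2
  haveI hmax := hQ.isMaximal hQ0
  letI := Ideal.Quotient.field Q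
  have hcard0 : Nat.card (𝓞 K ⧸ Q) = Ideal.absNorm Q := by
    rw [Ideal.absNorm_apply, Submodule.cardQuot_apply]
  haveI : Finite (𝓞 K ⧸ Q) := by
    apply Nat.finite_of_card_ne_zero
    rw [hcard0, Ne, Ideal.absNorm_eq_zero_iff]; exact hQ0
  letI := Fintype.ofFinite (𝓞 K ⧸ Q)
  have hcard : Fintype.card (𝓞 K ⧸ Q) = Ideal.absNorm Q := by
    rw [← Nat.card_eq_fintype_card, hcard0]
  obtain ⟨p, hchar⟩ := CharP.exists (𝓞 K ⧸ Q)
  obtain ⟨f, hp, hf⟩ := FiniteField.card (𝓞 K ⧸ Q) p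
  have hpQ : (p : 𝓞 K) ∈ Q := by
    rw [← Ideal.Quotient.eq_zero_iff_mem, map_natCast]
    exact CharP.cast_eq_zero _ p
  haveI : Fact p.Prime := ⟨hp⟩
  have hfrob : ∀ (k c : ℕ), ¬ 29 ∣ c → p ^ k % 29 = c % 29 → ∀ x : 𝓞 K,
      Ideal.Quotient.mk Q (sg hζ c x) = (Ideal.Quotient.mk Q x) ^ p ^ k := by
    intro k c hc hk x
    have := hom_ext29 hζ (f := (Ideal.Quotient.mk Q).comp (sg hζ c : 𝓞 K →+* 𝓞 K))
      (g := (iterateFrobenius (𝓞 K ⧸ Q) p k).comp (Ideal.Quotient.mk Q)) (by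
        rw [RingHom.comp_apply, RingHom.comp_apply, iterateFrobenius_def, ← map_pow]
        show Ideal.Quotient.mk Q (sg hζ c ζ) = _
        rw [sg_zeta hζ hc, ← pow_mod29 hζ.pow_eq_one c, ← hk, pow_mod29 hζ.pow_eq_one])
    have h2 := RingHom.congr_fun this x
    rw [RingHom.comp_apply, RingHom.comp_apply, iterateFrobenius_def] at h2
    exact h2
  have hp29 : p % 29 ≠ 0 := by
    intro h
    have h1 : 29 = p := (Nat.prime_dvd_prime_iff_eq (by norm_num) hp).mp (Nat.dvd_of_mod_eq_zero h)
    apply h29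
    rw [← h1] at hpQ
    exact_mod_cast hpQ
  rcases residues (p % 29) (Nat.mod_lt _ (by norm_num)) with h | ⟨k, -, h⟩ | h | ⟨h, h'⟩
  · exact absurd h hp29
  · rw [← Nat.pow_mod] at h
    refine (L3 hζ hQ ?_).pow 2
    have hle : Ideal.map (cj hζ) Q ≤ Q := by
      intro y hy
      obtain ⟨x, hx, rfl⟩ := (mem_map_e _).mp hy
      rw [← Ideal.Quotient.eq_zero_iff_mem, cj, hfrob k 28 (by norm_num) (by omega),
        Ideal.Quotient.eq_zero_iff_mem.mpr hx, zero_pow (pow_ne_zero _ hp.ne_zero)]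
    refine le_antisymm hle ?_
    have := Ideal.map_mono (f := cj hζ) hle
    rwa [cj_map_map] at this
  · refine L9 hζ hQ hQ0 h29 hp ?_
    have h1 : Fintype.card (𝓞 K ⧸ Q) ≤ p := by
      apply pow_le_card hp.one_lt
      intro y
      obtain ⟨x, rfl⟩ := Ideal.Quotient.mk_surjective y
      have := hfrob 1 1 (by norm_num) (by rw [pow_one]; omega) x
      rw [pow_one, sg_one] at this
      exact this.symm
    rw [← hcard]
    refine le_antisymm h1 ?_
    rw [hf]
    exact Nat.le_self_pow f.2.ne' p
  · have hf7 : 7 ≤ (f : ℕ) := by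
      by_contra hlt
      rcases h' f (by omega) with h1 | h1
      · exact f.2.ne' h1
      · apply h1
        rw [← Nat.pow_mod]
        have h2 := hζ.pow_eq_one
        have h3 : ζ ^ (p ^ (f : ℕ) - 1) - 1 ∈ Q := by
          rw [← Ideal.Quotient.eq_zero_iff_mem, map_sub, map_one, map_pow, ← hf,
            FiniteField.pow_card_sub_one_eq_one, sub_self]
          rw [Ne, Ideal.Quotient.eq_zero_iff_mem]
          intro h4
          exact hQ.ne_top (Ideal.eq_top_of_isUnit_mem _ h4 (hζ.isUnit (by norm_num)))
        have h4 := zeta_pow_mem hζ h29 h3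
        have h5 : 0 < p ^ (f : ℕ) := pow_pos hp.pos _
        omega
    have hplt : p < 29 := by
      by_contra hge
      have h1 : 29 ^ 7 ≤ p ^ (f : ℕ) :=
        (Nat.pow_le_pow_left (by omega) 7).trans (Nat.pow_le_pow_right hp.pos hf7)
      rw [hcard] at hf
      omega
    rw [Nat.mod_eq_of_lt hplt] at h
    rw [hcard] at hf
    have := hp.ne_zero
    rcases h with rfl | rfl | rfl | rfl | rfl | rfl
    · exact (gen_of_norm hζ hQ hQ0 hf hf7 hpQ this n7).pow 2
    · exact absurd hp (by norm_num)
    · exact absurd hp (by norm_num)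
    · exact (gen_of_norm hζ hQ hQ0 hf hf7 hpQ this n23).pow 2
    · exact absurd hp (by norm_num)
    · exact absurd hp (by norm_num)

theorem ideal_sq (hζ : IsPrimitiveRoot ζ 29) (I : Ideal (𝓞 K)) : I ≠ 0 →
    Ideal.absNorm I < 29 ^ 7 → Pr (I ^ 2) := by
  refine UniqueFactorizationMonoid.induction_on_prime I ?_ ?_ ?_
  · intro h; exact absurd rfl h
  · intro x hx _ _
    rw [Ideal.isUnit_iff.mp hx]
    exact ⟨1, by rw [← Ideal.one_eq_top, one_pow, Ideal.span_singleton_one, Ideal.one_eq_top]⟩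
  · intro a p ha hp ih h0 hB
    rw [map_mul] at hB
    have h1 : Ideal.absNorm p ≠ 0 := by rw [Ne, Ideal.absNorm_eq_zero_iff]; exact hp.ne_zero
    have h2 : Ideal.absNorm a ≠ 0 := by rw [Ne, Ideal.absNorm_eq_zero_iff]; exact ha
    rw [mul_pow]
    apply Pr.mul
    · exact prime_sq hζ (Ideal.isPrime_of_prime hp) hp.ne_zero
        (lt_of_le_of_lt (Nat.le_mul_of_pos_right _ (by omega)) hB)
    · exact ih ha (lt_of_le_of_lt (Nat.le_mul_of_pos_left _ (by omega)) hB)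

theorem mink_K {x : ℕ} (hx : (x : ℝ) ≤ (4 / Real.pi) ^ InfinitePlace.nrComplexPlaces K *
    ((Module.finrank ℚ K).factorial / (Module.finrank ℚ K : ℝ) ^ (Module.finrank ℚ K) *
      Real.sqrt |(NumberField.discr K : ℝ)|)) : x < 29 ^ 7 := by
  have h0 : InfinitePlace.nrComplexPlaces K = 14 := by
    rw [IsCyclotomicExtension.Rat.nrComplexPlaces_eq_totient_div_two 29 K, Nat.totient_prime (by norm_num)]
  rw [h0, finrank29] at hx
  have h1 : |(NumberField.discr K : ℝ)| = 29 ^ 27 := by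
    have := natAbs_discr29 (K := K)
    rw [← Int.cast_abs, Int.abs_eq_natAbs, this]; norm_num
  have h2 : Real.sqrt |(NumberField.discr K : ℝ)| ≤ 55268 * 10 ^ 15 := by
    rw [h1, Real.sqrt_le_left (by norm_num)]; norm_num
  have h3 : 4 / Real.pi ≤ 4 / 3.1415 := by
    gcongr; exact Real.pi_gt_d4.le
  have h4 : (4 / Real.pi) ^ 14 ≤ (4 / 3.1415 : ℝ) ^ 14 := by gcongr
  have h5 := mul_le_mul h4 (mul_le_mul_of_nonneg_left h2 (by positivity :
    (0 : ℝ) ≤ ((28 : ℕ).factorial : ℝ) / ((28 : ℕ) : ℝ) ^ 28)) (by positivity) (by positivity)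
  have h6 : (4 / 3.1415 : ℝ) ^ 14 * (((28 : ℕ).factorial : ℝ) / ((28 : ℕ) : ℝ) ^ 28 * (55268 * 10 ^ 15)) < 29 ^ 7 := by
    norm_num [Nat.factorial]
  have h7 : (x : ℝ) < ((29 ^ 7 : ℕ) : ℝ) := by push_cast; linarith
  exact Nat.cast_lt.mp h7

theorem all_sq (hζ : IsPrimitiveRoot ζ 29) (x : ClassGroup (𝓞 K)) : x * x = 1 := by
  obtain ⟨I, rfl, hI⟩ := exists_ideal_in_class_of_norm_le x
  have h0 : (I : Ideal (𝓞 K)) ≠ ⊥ := nonZeroDivisors.ne_zero I.2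
  have h1 := ideal_sq hζ I h0 (mink_K hI)
  rw [← cl_zero_iff (pow_ne_zero 2 h0), cl_pow h0, cl, dif_pos h0, two_nsmul] at h1
  exact h1

theorem all_sq' (hζ : IsPrimitiveRoot ζ 29) {I : Ideal (𝓞 K)} (hI : I ≠ ⊥) : Pr (I ^ 2) := by
  rw [← cl_zero_iff (pow_ne_zero 2 hI), cl_pow hI, two_nsmul]
  exact all_sq hζ (Additive.toMul (cl I))

end P12

section P13
set_option linter.unusedSectionVars false
set_option linter.style.haveILetI false
set_option linter.unusedVariables false

variable {K : Type} [Field K] [NumberField K] [IsCyclotomicExtension {(29 : ℕ)} ℚ K] {ζ : 𝓞 K}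

theorem cl_surj (x : Additive (ClassGroup (𝓞 K))) : ∃ I : Ideal (𝓞 K), I ≠ ⊥ ∧ cl I = x := by
  obtain ⟨I, hI⟩ := ClassGroup.mk0_surjective (Additive.toMul x)
  have h0 : (I : Ideal (𝓞 K)) ≠ ⊥ := nonZeroDivisors.ne_zero I.2
  refine ⟨I, h0, ?_⟩
  rw [cl, dif_pos h0]
  exact hI

theorem all_sq2 (hζ : IsPrimitiveRoot ζ 29) (x : Additive (ClassGroup (𝓞 K))) : x + x = 0 :=
  all_sq hζ (Additive.toMul x)

theorem class_data (hζ : IsPrimitiveRoot ζ 29) (x : Additive (ClassGroup (𝓞 K))) :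
    ∃ (a : Fin 3 → ZMod 2) (I : Ideal (𝓞 K)) (α π : 𝓞 K) (u v : (𝓞 K)ˣ), I ≠ ⊥ ∧ cl I = x ∧
      I ^ 2 = Ideal.span {α} ∧ cj hζ π = π ∧ I * Ideal.map (cj hζ) I = Ideal.span {π} ∧
      α * cj hζ α = π ^ 2 * u ∧ u = gp hζ (ke a) * v ^ 2 ∧ cj hζ (v : 𝓞 K) = v := by
  obtain ⟨I, hI, hx⟩ := cl_surj x
  obtain ⟨α, h1⟩ := all_sq' hζ hI
  obtain ⟨π, u, hπ, h2, h3, hu, hs⟩ := udata hζ hI h1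
  obtain ⟨a, v, h4, hv⟩ := T4 hζ u hu hs
  exact ⟨a, I, α, π, u, v, hI, hx, h1, hπ, h2, h3, h4, hv⟩

theorem card_le (hζ : IsPrimitiveRoot ζ 29) :
    Finite (Additive (ClassGroup (𝓞 K))) ∧ Nat.card (Additive (ClassGroup (𝓞 K))) ≤ 8 := by
  choose a I α π u v hI hx h1 hπ h2 h3 h4 hv using class_data hζ
  have hinj : Function.Injective a := by
    intro x x' h
    have h4' := h4 x'
    rw [← h] at h4'
    obtain ⟨w, hw, hwr⟩ := T6 hζ (h4 x) h4' (hv x) (hv x')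
    have := L7 hζ (P := I x * I x') (α := α x * α x') (π := π x * π x') (v := w) (mul_ne_zero (hI x) (hI x'))
      (by rw [mul_pow, h1, h1, Ideal.span_singleton_mul_span_singleton])
      (by rw [Ideal.map_mul, ← Ideal.span_singleton_mul_span_singleton, ← h2, ← h2]; ring)
      (by rw [map_mul, hπ, hπ]) hwr
      (by
        rw [← hw, map_mul]
        linear_combination (α x' * cj hζ (α x')) * h3 x + (π x ^ 2 * (u x : 𝓞 K)) * h3 x')
    rw [← cl_zero_iff (mul_ne_zero (hI x) (hI x')), cl_mul (hI x) (hI x'), hx, hx] at this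
    have h5 := all_sq2 hζ x'
    exact add_right_cancel (this.trans h5.symm)
  refine ⟨Finite.of_injective a hinj, ?_⟩
  have := Nat.card_le_card_of_injective a hinj
  rw [Nat.card_eq_fintype_card (α := Fin 3 → ZMod 2)] at this
  simpa [ZMod.card] using this

theorem abs_iso {V : Type*} [AddCommGroup V] (h2 : ∀ x : V, x + x = 0) (y : Fin 3 → V)
    (hy : ∀ s : Finset (Fin 3), ∑ i ∈ s, y i = 0 → s = ∅) (hc : Finite V ∧ Nat.card V ≤ 8) :
    ∃ f : (Fin 3 → ZMod 2) →+ V, Function.Bijective f := by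
  letI : Module (ZMod 2) V := AddCommGroup.zmodModule (n := 2) (fun x => by rw [two_nsmul, h2])
  haveI := hc.1
  let f : (Fin 3 → ZMod 2) →+ V :=
    { toFun := fun e => ∑ i, e i • y i
      map_zero' := by simp
      map_add' := fun e e' => by
        rw [← Finset.sum_add_distrib]
        exact Finset.sum_congr rfl fun i _ => by rw [Pi.add_apply, add_smul] }
  have hz : ∀ t : ZMod 2, t = 0 ∨ t = 1 := by decide
  have hf : Function.Injective f := by
    rw [injective_iff_map_eq_zero]
    intro e he
    have h1 : ∑ i ∈ Finset.univ.filter (fun i => e i = 1), y i = 0 := by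
      have he' : ∑ i, e i • y i = 0 := he
      rw [← he', Finset.sum_filter]
      apply Finset.sum_congr rfl
      intro i _
      rcases hz (e i) with h | h
      · rw [h, zero_smul, if_neg (by decide)]
      · rw [h, one_smul, if_pos rfl]
    have h3 := hy _ h1
    funext i
    rcases hz (e i) with h | h
    · exact h
    · have : i ∈ Finset.univ.filter (fun i => e i = 1) := by simp [h]
      rw [h3] at this
      simp at this
  refine ⟨f, Function.Injective.bijective_of_nat_card_le hf ?_⟩
  rw [Nat.card_eq_fintype_card (α := Fin 3 → ZMod 2)]
  simpa [ZMod.card] using hc.2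

theorem abs_iso2 {C : Type*} [CommGroup C] {f : (Fin 3 → ZMod 2) →+ Additive C} (hf : Function.Bijective f) :
    Nonempty (C ≃* (Multiplicative (ZMod 2) × Multiplicative (ZMod 2) × Multiplicative (ZMod 2))) ∧
      Nat.card C = 8 := by
  let e : (Fin 3 → ZMod 2) ≃+ Additive C := AddEquiv.ofBijective f hf
  constructor
  · let g : C → (Multiplicative (ZMod 2) × Multiplicative (ZMod 2) × Multiplicative (ZMod 2)) :=
      fun x => (Multiplicative.ofAdd (e.symm (Additive.ofMul x) 0), Multiplicative.ofAdd (e.symm (Additive.ofMul x) 1),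
        Multiplicative.ofAdd (e.symm (Additive.ofMul x) 2))
    refine ⟨MulEquiv.ofBijective (MonoidHom.mk' g ?_) ⟨?_, ?_⟩⟩
    · intro a b
      simp only [g, ofMul_mul, map_add, Pi.add_apply, ofAdd_add, Prod.mk_mul_mk]
    · intro a b h
      have h1 : e.symm (Additive.ofMul a) = e.symm (Additive.ofMul b) := by
        simp only [g, MonoidHom.mk'_apply, Prod.mk.injEq] at h
        funext i
        fin_cases i
        · exact h.1
        · exact h.2.1
        · exact h.2.2
      exact e.symm.injective h1
    · intro ⟨a, b, c⟩
      refine ⟨Additive.toMul (e ![Multiplicative.toAdd a, Multiplicative.toAdd b, Multiplicative.toAdd c]), ?_⟩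
      simp [g]
  · have := Nat.card_congr e.toEquiv
    rw [Nat.card_eq_fintype_card (α := Fin 3 → ZMod 2)] at this
    have h : Nat.card C = Nat.card (Additive C) := rfl
    rw [h, ← this]
    simp [ZMod.card]

end P13

section P14
set_option linter.unusedSectionVars false
set_option linter.style.haveILetI false
set_option linter.unusedVariables false

variable {K : Type} [Field K] [NumberField K] [IsCyclotomicExtension {(29 : ℕ)} ℚ K] {ζ : 𝓞 K}

def sgc (n : ℕ) : ZMod 2 := if min (n % 29) (29 - n % 29) ≤ 8 then 0 else 1

theorem cos_red (n : ℕ) : Real.cos (2 * Real.pi * n / 29) =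
    Real.cos (2 * Real.pi * (min (n % 29) (29 - n % 29) : ℕ) / 29) := by
  have h0 : n % 29 < 29 := Nat.mod_lt _ (by norm_num)
  have h1 : 2 * Real.pi * n / 29 = 2 * Real.pi * (n % 29 : ℕ) / 29 + (n / 29 : ℕ) * (2 * Real.pi) := by
    have : (n : ℝ) = 29 * (n / 29 : ℕ) + (n % 29 : ℕ) := by exact_mod_cast (Nat.div_add_mod n 29).symm
    rw [show 2 * Real.pi * (n : ℝ) / 29 = (2 * Real.pi / 29) * n by ring]
    generalize (n / 29 : ℕ) = q at *
    generalize (n % 29 : ℕ) = r at *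
    rw [this]; ring
  rw [h1, Real.cos_add_nat_mul_two_pi]
  rcases le_total (n % 29) (29 - n % 29) with h | h
  · rw [min_eq_left h]
  · rw [min_eq_right h, Nat.cast_sub h0.le, ← Real.cos_two_pi_sub]
    congr 1
    push_cast
    ring

theorem cos_sign (n : ℕ) : (sgc n = 0 ∧ 0 < 4 * Real.cos (2 * Real.pi * n / 29) + 1) ∨
    (sgc n = 1 ∧ 4 * Real.cos (2 * Real.pi * n / 29) + 1 < 0) := by
  rw [cos_red]
  have hm : min (n % 29) (29 - n % 29) ≤ 14 := by omega
  unfold sgc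
  generalize min (n % 29) (29 - n % 29) = m at *
  have hpi := Real.pi_pos
  have hpi1 := Real.pi_gt_d2
  have hpi2 := Real.pi_lt_d2
  by_cases h : m ≤ 8
  · left
    refine ⟨if_pos h, ?_⟩
    have hm' : (m : ℝ) ≤ 8 := by exact_mod_cast h
    have h1 : Real.cos (2 * Real.pi * 8 / 29) ≤ Real.cos (2 * Real.pi * m / 29) := by
      apply Real.cos_le_cos_of_nonneg_of_le_pi
      · positivity
      · linarith
      · gcongr
    have h2 : Real.cos (2 * Real.pi * 8 / 29) = - Real.sin (3 * Real.pi / 58) := by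
      rw [← Real.cos_add_pi_div_two]; congr 1; ring
    have h3 := Real.sin_lt (by positivity : 0 < 3 * Real.pi / 58)
    linarith
  · right
    refine ⟨if_neg h, ?_⟩
    have hm' : (9 : ℝ) ≤ m := by exact_mod_cast (by omega : 9 ≤ m)
    have hm2 : (m : ℝ) ≤ 14 := by exact_mod_cast hm
    have h1 : Real.cos (2 * Real.pi * m / 29) ≤ Real.cos (2 * Real.pi * 9 / 29) := by
      apply Real.cos_le_cos_of_nonneg_of_le_pi
      · positivity
      · have : 2 * Real.pi * m ≤ 2 * Real.pi * 14 := by gcongr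
        linarith
      · gcongr
    have h2 : Real.cos (2 * Real.pi * 9 / 29) = - Real.sin (7 * Real.pi / 58) := by
      rw [← Real.cos_add_pi_div_two]; congr 1; ring
    have h3 := Real.sin_gt_sub_cube (x := 7 * Real.pi / 58) (by positivity)
    have h4 : (7 * Real.pi / 58) ^ 3 ≤ (0.3803 : ℝ) ^ 3 := by
      gcongr
      linarith
    norm_num at h4
    linarith

/-- the prime element 1 + 2(ζ + ζ⁻¹) of norm 20011 -/
def pz (ζ : 𝓞 K) : 𝓞 K := 2 * (ζ + ζ ^ 28) + 1

theorem pz_cj (hζ : IsPrimitiveRoot ζ 29) : cj hζ (pz ζ) = pz ζ := by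
  have h1 := cj_zeta_pow hζ (k := 1) (by norm_num)
  have h28 := cj_zeta_pow hζ (k := 28) (by norm_num)
  rw [pow_one] at h1
  norm_num at h1
  replace h28 : cj hζ (ζ ^ 28) = ζ := by simpa using h28
  simp only [pz, map_add, map_mul, map_one, map_ofNat]
  rw [h1, h28]; ring

theorem pz_dvd (hζ : IsPrimitiveRoot ζ 29) : pz ζ ∣ (20011 : 𝓞 K) := by
  have h1 : Algebra.norm ℤ (ev (fun k => ζ ^ k) [(1,0),(2,1),(2,28)]) = 20011 ^ 2 := norm_ev hζ (by decide +kernel)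
  have h2 : ev (fun k => ζ ^ k) [(1,0),(2,1),(2,28)] = pz ζ := by
    simp [ev, pz]; ring
  rw [h2] at h1
  have h3 : pz ζ ∣ ∏ c ∈ Finset.Icc 1 14, sg hζ c (pz ζ) := by
    have := Finset.dvd_prod_of_mem (fun c => sg hζ c (pz ζ)) (Finset.mem_Icc.mpr ⟨le_refl 1, by norm_num⟩ : 1 ∈ Finset.Icc 1 14)
    simpa only [sg_one] using this
  rcases prod_half_eq hζ (pz_cj hζ) h1 with h | h
  · rw [h] at h3; exact_mod_cast h3
  · rw [h, dvd_neg] at h3; exact_mod_cast h3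

theorem d29 (hζ : IsPrimitiveRoot ζ 29) : ζ - ζ ^ 28 ∣ (29 : 𝓞 K) := by
  have h1 : Algebra.norm ℤ (ev (fun k => ζ ^ k) [(1,1),(-1,28)]) = 29 := norm_ev hζ (by decide +kernel)
  have h2 : ev (fun k => ζ ^ k) [(1,1),(-1,28)] = ζ - ζ ^ 28 := by
    simp [ev]; ring
  rw [h2] at h1
  have h3 := norm29_prod hζ (ζ - ζ ^ 28)
  have h4 : ζ - ζ ^ 28 ∣ ∏ c ∈ Finset.Icc 1 28, sg hζ c (ζ - ζ ^ 28) := by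
    have := Finset.dvd_prod_of_mem (fun c => sg hζ c (ζ - ζ ^ 28)) (Finset.mem_Icc.mpr ⟨le_refl 1, by norm_num⟩ : 1 ∈ Finset.Icc 1 28)
    simpa only [sg_one] using this
  rw [← h3, h1] at h4
  exact_mod_cast h4

theorem pz_ne (hζ : IsPrimitiveRoot ζ 29) : pz ζ ≠ 0 := by
  intro h
  have := pz_dvd hζ
  rw [h, zero_dvd_iff] at this
  norm_num at this

def Az (ζ : 𝓞 K) : Ideal (𝓞 K) := Ideal.span {pz ζ, ζ - 173}

theorem Az_ne (hζ : IsPrimitiveRoot ζ 29) : Az ζ ≠ ⊥ := by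
  intro h
  have : pz ζ ∈ Az ζ := Ideal.subset_span (by simp)
  rw [h] at this
  exact pz_ne hζ this

theorem Az_mul (hζ : IsPrimitiveRoot ζ 29) : Az ζ * Ideal.map (cj hζ) (Az ζ) = Ideal.span {pz ζ} := by
  have hz : cj hζ ζ = ζ ^ 28 := by
    have := cj_zeta_pow hζ (k := 1) (by norm_num)
    simpa using this
  have hm : Ideal.map (cj hζ) (Az ζ) = Ideal.span {pz ζ, ζ ^ 28 - 173} := by
    rw [Az, Ideal.map_span, Set.image_pair, pz_cj, map_sub, hz, map_ofNat]
  have h29 := hζ.pow_eq_one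
  obtain ⟨t, ht⟩ := pz_dvd hζ
  obtain ⟨s, hs⟩ := d29 hζ
  rw [hm, Az]
  apply le_antisymm
  · rw [Ideal.span_pair_mul_span_pair, Ideal.span_le]
    intro x hx
    simp only [Set.mem_insert_iff, Set.mem_singleton_iff] at hx
    rw [SetLike.mem_coe, Ideal.mem_span_singleton]
    rcases hx with rfl | rfl | rfl | rfl
    · exact Dvd.intro _ rfl
    · exact Dvd.intro _ rfl
    · exact Dvd.intro_left _ rfl
    · -- 2 x = 20011 * 3 - 173 π
      refine ⟨t * (ζ - 173) * (ζ ^ 28 - 173) - 10005 * (3 * t - 173), ?_⟩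
      have e : 2 * ((ζ - 173) * (ζ ^ 28 - 173)) = 20011 * 3 - 173 * pz ζ := by
        unfold pz
        linear_combination 2 * h29
      linear_combination ((ζ - 173) * (ζ ^ 28 - 173) - 10005 * 3) * ht - 10005 * e
  · rw [Ideal.span_singleton_le_iff_mem]
    have hA : ∀ a b : 𝓞 K, a ∈ ({pz ζ, ζ - 173} : Set (𝓞 K)) → b ∈ ({pz ζ, ζ ^ 28 - 173} : Set (𝓞 K)) →
        a * b ∈ Ideal.span {pz ζ, ζ - 173} * Ideal.span {pz ζ, ζ ^ 28 - 173} :=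
      fun a b ha hb => Ideal.mul_mem_mul (Ideal.subset_span ha) (Ideal.subset_span hb)
    have m1 := hA (pz ζ) (pz ζ) (by simp) (by simp)
    have m2 := hA (pz ζ) (ζ ^ 28 - 173) (by simp) (by simp)
    have m3 := hA (ζ - 173) (pz ζ) (by simp) (by simp)
    have m4 := Ideal.mul_mem_left _ t m1
    have m5 := Ideal.mul_mem_left _ s (Ideal.sub_mem _ m3 m2)
    -- 690 * 29 = 20010
    convert Ideal.sub_mem _ m4 (Ideal.mul_mem_left _ 690 m5) using 1
    linear_combination pz ζ * ht - 690 * pz ζ * hs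

def cz : Fin 3 → ℕ := ![8, 6, 11]

theorem cz_ne : ∀ i : Fin 3, ¬ 29 ∣ cz i := by decide

theorem Fs_cert : ∀ i k : Fin 3, ∑ j : Fin 14, bt Sl k j * sgc (cz i * (j + 1)) = if i = k then 1 else 0 := by
  decide +kernel

theorem sb_pz (hζ : IsPrimitiveRoot ζ 29) (i : Fin 3) (j : Fin 14) :
    sb hζ j (sg hζ (cz i) (pz ζ)) = sgc (cz i * (j + 1)) := by
  have hcz : cz i ≤ 29 := by revert i; decide
  have h1 : sg hζ (cz i) (pz ζ) = 2 * (ζ ^ (cz i) + cj hζ (ζ ^ (cz i))) + 1 := by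
    have : pz ζ = 2 * (ζ + cj hζ ζ) + 1 := by
      have := cj_zeta_pow hζ (k := 1) (by norm_num)
      rw [pow_one] at this
      rw [this]; rfl
    rw [this]
    simp only [map_add, map_mul, map_one, map_ofNat]
    rw [← cj_sg hζ (cz_ne i), sg_zeta hζ (cz_ne i)]
  have h0 : emj hζ j (ζ ^ (cz i)) = Complex.exp ((2 * Real.pi * (cz i * (j + 1) : ℕ) / 29 : ℝ) * Complex.I) := by
    rw [map_pow, emj_zeta, ← pow_mul, ← Complex.exp_nat_mul]
    congr 1; push_cast; ring
  have h2 : (emj hζ j (sg hζ (cz i) (pz ζ))).re = 4 * Real.cos (2 * Real.pi * (cz i * (j + 1) : ℕ) / 29) + 1 := by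
    rw [h1]
    simp only [map_add, map_mul, map_one, map_ofNat]
    rw [emb_cj, h0, Complex.add_conj, Complex.exp_ofReal_mul_I_re]
    have : (2 * ((2 * Real.cos (2 * Real.pi * (cz i * (j + 1) : ℕ) / 29) : ℝ) : ℂ) + 1) =
      ((4 * Real.cos (2 * Real.pi * (cz i * (j + 1) : ℕ) / 29) + 1 : ℝ) : ℂ) := by push_cast; ring
    rw [this, Complex.ofReal_re]
  unfold sb
  rw [h2]
  rcases cos_sign (cz i * (j + 1)) with ⟨ha, hb⟩ | ⟨ha, hb⟩
  · rw [if_pos hb, ha]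
  · rw [if_neg (not_lt.mpr hb.le), ha]

theorem Fs_pz (hζ : IsPrimitiveRoot ζ 29) (i k : Fin 3) :
    Fs hζ k (sg hζ (cz i) (pz ζ)) = if i = k then 1 else 0 := by
  rw [← Fs_cert, Fs]
  exact Finset.sum_congr rfl fun j _ => by rw [sb_pz]

theorem indep (hζ : IsPrimitiveRoot ζ 29) (s : Finset (Fin 3))
    (hs : ∑ i ∈ s, cl (Ideal.map (sg hζ (cz i)) (Az ζ)) = 0) : s = ∅ := by
  have hne : ∀ i, Ideal.map (sg hζ (cz i)) (Az ζ) ≠ ⊥ := fun i => map_e_ne_bot _ (Az_ne hζ)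
  rw [← cl_prod _ _ (fun i _ => hne i), cl_zero_iff (Finset.prod_ne_zero_iff.mpr fun i _ => hne i)] at hs
  obtain ⟨α, hα⟩ := hs
  have hα0 : α ≠ 0 := by
    rintro rfl
    rw [Ideal.span_singleton_zero] at hα
    exact (Finset.prod_ne_zero_iff.mpr fun i (_ : i ∈ s) => hne i) hα
  let p : Fin 3 → 𝓞 K := fun i => sg hζ (cz i) (pz ζ)
  have hpr : ∀ i, cj hζ (p i) = p i := fun i => by
    simp only [p]; rw [cj_sg hζ (cz_ne i), pz_cj]
  have hp0 : ∀ i, p i ≠ 0 := fun i => by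
    simp only [p]; rw [Ne, map_eq_zero_iff _ (RingEquiv.injective _)]; exact pz_ne hζ
  have hmul : ∀ i, Ideal.map (sg hζ (cz i)) (Az ζ) * Ideal.map (cj hζ) (Ideal.map (sg hζ (cz i)) (Az ζ)) =
      Ideal.span {p i} := fun i => by
    rw [cj_map_sg hζ (cz_ne i), ← Ideal.map_mul, Az_mul, map_e_span]
  have hprod : Ideal.span {∏ i ∈ s, p i} = Ideal.span {α * cj hζ α} := by
    rw [← Ideal.prod_span_singleton, ← Ideal.span_singleton_mul_span_singleton, ← map_e_span, ← hα]
    have : Ideal.map (cj hζ) (∏ i ∈ s, Ideal.map (sg hζ (cz i)) (Az ζ)) =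
        ∏ i ∈ s, Ideal.map (cj hζ) (Ideal.map (sg hζ (cz i)) (Az ζ)) :=
      map_prod (Ideal.mapHom (cj hζ)) _ s
    rw [this, ← Finset.prod_mul_distrib]
    exact Finset.prod_congr rfl fun i _ => (hmul i).symm
  obtain ⟨u, hu⟩ := Ideal.span_singleton_eq_span_singleton.mp hprod
  have hP : ∀ t : Finset (Fin 3), cj hζ (∏ i ∈ t, p i) = ∏ i ∈ t, p i ∧ ∏ i ∈ t, p i ≠ 0 ∧
      ∀ k, Fs hζ k (∏ i ∈ t, p i) = ∑ i ∈ t, if i = k then 1 else 0 := by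
    intro t
    have a1 : ∀ t : Finset (Fin 3), cj hζ (∏ i ∈ t, p i) = ∏ i ∈ t, p i := fun t => by
      rw [map_prod]; exact Finset.prod_congr rfl fun i _ => hpr i
    have a2 : ∀ t : Finset (Fin 3), ∏ i ∈ t, p i ≠ 0 := fun t => Finset.prod_ne_zero_iff.mpr fun i _ => hp0 i
    refine ⟨a1 t, a2 t, fun k => ?_⟩
    induction t using Finset.induction_on with
    | empty => simp [Fs, sb_one]
    | insert i t hi ih =>
      rw [Finset.prod_insert hi, Finset.sum_insert hi, Fs_mul hζ k (hpr i) (a1 t) (hp0 i) (a2 t), ih, Fs_pz]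
  obtain ⟨b1, b2, b3⟩ := hP s
  have hur : cj hζ (u : 𝓞 K) = u := by
    have h := congrArg (cj hζ) hu
    rw [map_mul, b1, map_mul, cj_cj, mul_comm (cj hζ α), ← hu] at h
    exact mul_left_cancel₀ b2 h
  by_contra hne'
  obtain ⟨k, hk⟩ := Finset.nonempty_iff_ne_empty.mpr hne'
  have h1 : Fs hζ k (α * cj hζ α) = 0 := by
    unfold Fs
    exact Finset.sum_eq_zero fun j _ => by rw [sb_norm hζ j hα0, mul_zero]
  rw [← hu, Fs_mul hζ k b1 hur b2 u.ne_zero, T7 hζ u hur, add_zero, b3, Finset.sum_ite_eq', if_pos hk] at h1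
  exact absurd h1 (by decide)

end P14

/-- The ideal class group of the 29th cyclotomic field is isomorphic to
`(ℤ/2ℤ)³`, and complex conjugation induces the identity on it. Consequently the subgroup
`{x · x̄⁻¹ : x ∈ Cl₂₉}` is trivial, while `{x ∈ Cl₂₉ : x̄ = x⁻¹}` is the whole class group,
of order `8`. -/
theorem stmt_12
    (K : Type) [Field K] [NumberField K] [IsCyclotomicExtension {(29 : ℕ)} ℚ K]
    (ζ : 𝓞 K) (hζ : IsPrimitiveRoot ζ 29)
    (σ : 𝓞 K ≃+* 𝓞 K) (hσ : σ ζ * ζ = 1)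
    (J : ClassGroup (𝓞 K) →* ClassGroup (𝓞 K))
    (hJ : ∀ I I' : (Ideal (𝓞 K))⁰,
      Ideal.map σ (I : Ideal (𝓞 K)) = (I' : Ideal (𝓞 K)) →
      J (ClassGroup.mk0 I) = ClassGroup.mk0 I') :
    Nonempty (ClassGroup (𝓞 K) ≃*
      (Multiplicative (ZMod 2) × Multiplicative (ZMod 2) × Multiplicative (ZMod 2))) ∧
    (∀ x : ClassGroup (𝓞 K), J x = x) ∧
    (∀ x : ClassGroup (𝓞 K), x * (J x)⁻¹ = 1) ∧
    (∀ x : ClassGroup (𝓞 K), J x = x⁻¹) ∧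
    Nat.card (ClassGroup (𝓞 K)) = 8 := by
  obtain ⟨f, hf⟩ := abs_iso (all_sq2 hζ) _ (indep hζ) (card_le hζ)
  obtain ⟨h1, h2⟩ := abs_iso2 hf
  have hσ' : σ = cj hζ := by
    apply equiv_ext29 hζ
    exact mul_right_cancel₀ (hζ.ne_zero (by norm_num)) (hσ.trans (cj_zeta hζ).symm)
  have h3 : ∀ x : ClassGroup (𝓞 K), x⁻¹ = x := fun x => inv_eq_of_mul_eq_one_left (all_sq hζ x)
  have h4 : ∀ x : ClassGroup (𝓞 K), J x = x⁻¹ := by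
    intro x
    obtain ⟨I, rfl⟩ := ClassGroup.mk0_surjective x
    have h0 : (I : Ideal (𝓞 K)) ≠ ⊥ := nonZeroDivisors.ne_zero I.2
    have h0' : Ideal.map σ (I : Ideal (𝓞 K)) ≠ ⊥ := map_e_ne_bot σ h0
    rw [hJ I ⟨_, mem_nonZeroDivisors_of_ne_zero h0'⟩ rfl, eq_inv_iff_mul_eq_one]
    obtain ⟨p, -, hp⟩ := L2 hζ (I : Ideal (𝓞 K))
    rw [← hσ', mul_comm] at hp
    have h5 := (cl_zero_iff (mul_ne_zero h0' h0)).mpr ⟨p, hp⟩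
    rw [cl_mul h0' h0, cl, cl, dif_pos h0', dif_pos h0] at h5
    exact h5
  have h5 : ∀ x : ClassGroup (𝓞 K), J x = x := fun x => (h4 x).trans (h3 x)
  exact ⟨h1, h5, fun x => by rw [h5, mul_inv_cancel], h4, h2⟩
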